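/- arXiv:1908.05323 — 13 statements merged into one kernel-verified Lean document; each statement's English description precedes it below -/
import Mathlib

section
/- Let K ⊂ ℝ be a nonempty compact set and let a, b ∈ C(K,ℝ). The linear span L₀ = span{β ↦ a(β)^k b(β) : k ∈ ℕ} is dense in C(K,ℝ) with respect to the supremum norm (i.e., the single-input scalar linear ensemble dx/dt(t,β) = a(β)x(t,β) + b(β)u(t) is uniformly ensemble controllable on C(K,ℝ)) if and only if (i) a is injective on K and (ii) b(β) ≠ 0 for every β ∈ K. -/
theorem stmt0_aux (K : Set ℝ) (a b : C(K, ℝ))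
    (h : Dense (↑(Submodule.span ℝ {f : C(K, ℝ) | ∃ k : ℕ, f = a ^ k * b}) : Set C(K, ℝ)))
    (x y : K) (p q : ℝ) (hk : ∀ k : ℕ, p * (a x ^ k * b x) + q * (a y ^ k * b y) = 0)
    (f : C(K, ℝ)) : p * f x + q * f y = 0 := by
  have hc : IsClosed {f : C(K, ℝ) | p * f x + q * f y = 0} :=
    isClosed_eq (by fun_prop) continuous_const
  have hs : (↑(Submodule.span ℝ {f : C(K, ℝ) | ∃ k : ℕ, f = a ^ k * b}) : Set C(K, ℝ)) ⊆
      {f : C(K, ℝ) | p * f x + q * f y = 0} := by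
    intro g hg
    induction hg using Submodule.span_induction with
    | mem g hg => obtain ⟨k, rfl⟩ := hg; simpa using hk k
    | zero => simp
    | add u v _ _ hu hv =>
      simp only [Set.mem_ofPred_eq, ContinuousMap.add_apply] at *
      linear_combination hu + hv
    | smul c u _ hu =>
      simp only [Set.mem_ofPred_eq, ContinuousMap.smul_apply, smul_eq_mul] at *
      linear_combination c * hu
  exact closure_minimal hs hc (h f)

/-- The single-input scalar linear ensemble `ẋ(t,β) = a(β)x(t,β) + b(β)u(t)`
is uniformly ensemble controllable on `C(K,ℝ)` (i.e. the span of `{a^k·b : k ∈ ℕ}` is dense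
in `C(K,ℝ)` w.r.t. the sup norm) iff `a` is injective and `b` is nowhere vanishing on `K`. -/
theorem stmt0 (K : Set ℝ) (hK : IsCompact K) (hKne : K.Nonempty)
    (a b : C(K, ℝ)) :
    Dense (↑(Submodule.span ℝ {f : C(K, ℝ) | ∃ k : ℕ, f = a ^ k * b}) : Set C(K, ℝ)) ↔
      Function.Injective a ∧ ∀ β : K, b β ≠ 0 := by
  have : CompactSpace K := isCompact_iff_compactSpace.mp hK
  constructor
  · intro h
    have hb : ∀ β : K, b β ≠ 0 := by
      intro β hβ
      have := stmt0_aux K a b h β β 1 0 (by simp [hβ]) 1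
      simp at this
    refine ⟨?_, hb⟩
    intro x y hxy
    have key := stmt0_aux K a b h x y (b y) (-b x) (by intro k; rw [hxy]; ring)
    have h1 := key 1
    have h2 := key ⟨fun z => (z : ℝ), continuous_subtype_val⟩
    simp only [ContinuousMap.one_apply, ContinuousMap.coe_mk] at h1 h2
    have h3 : b y * ((x : ℝ) - y) = 0 := by linear_combination h2 - (y : ℝ) * h1
    rcases mul_eq_zero.mp h3 with h4 | h4
    · exact absurd h4 (hb y)
    · exact Subtype.ext (sub_eq_zero.mp h4)
  · rintro ⟨ha, hb⟩
    have htop := ContinuousMap.subalgebra_topologicalClosure_eq_top_of_separatesPoints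
      (Polynomial.aeval (R := ℝ) a).range (by
        intro x y hxy
        exact ⟨a, ⟨a, ⟨Polynomial.X, by simp⟩, rfl⟩, fun h => hxy (ha h)⟩)
    have hd : DenseRange (Polynomial.aeval (R := ℝ) a) := by
      intro f
      have : f ∈ (Polynomial.aeval (R := ℝ) a).range.topologicalClosure := by
        rw [htop]; trivial
      rw [← SetLike.mem_coe, Subalgebra.topologicalClosure_coe, AlgHom.coe_range] at this
      exact this
    have hsurj : Function.Surjective (fun f : C(K, ℝ) => f * b) := by
      intro g
      refine ⟨⟨fun z => g z / b z, g.continuous.div b.continuous hb⟩, ?_⟩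
      ext z
      simp [hb z]
    have hd2 := hsurj.denseRange.comp hd (by fun_prop)
    refine Dense.mono ?_ hd2
    rintro _ ⟨p, rfl⟩
    simp only [Function.comp_apply, SetLike.mem_coe]
    rw [Polynomial.aeval_eq_sum_range, Finset.sum_mul]
    refine Submodule.sum_mem _ fun i _ => ?_
    rw [smul_mul_assoc]
    exact Submodule.smul_mem _ _ (Submodule.subset_span ⟨i, rfl⟩)
end

section
/- Let K ⊂ ℝ be a nonempty compact set and let a, b₁, …, b_m ∈ C(K,ℝ). The linear span L₀ = span{β ↦ a(β)^k b_i(β) : k ∈ ℕ, 1 ≤ i ≤ m} is dense in C(K,ℝ) with respect to the supremum norm if and only if for every η in the image a(K), the restrictions b₁|_{a⁻¹(η)}, …, b_m|_{a⁻¹(η)} span the space C(a⁻¹(η),ℝ) of continuous real-valued functions on the fiber a⁻¹(η) = {β ∈ K : a(β) = η}. -/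
theorem stmt1_fwd (K : Set ℝ) [CompactSpace K]
    (m : ℕ) (a : C(K, ℝ)) (b : Fin m → C(K, ℝ))
    (hd : Dense (↑(Submodule.span ℝ
        {f : C(K, ℝ) | ∃ (k : ℕ) (i : Fin m), f = a ^ k * b i}) : Set C(K, ℝ))) (η : ℝ) :
        Submodule.span ℝ
          (Set.range fun i : Fin m =>
            ContinuousMap.restrict {β : K | a β = η} (b i)) = ⊤ := by
  have hcl : IsClosed {β : K | a β = η} := isClosed_eq a.continuous continuous_const
  haveI : CompactSpace {β : K | a β = η} := isCompact_iff_compactSpace.mp hcl.isCompact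
  set V := Submodule.span ℝ
          (Set.range fun i : Fin m =>
            ContinuousMap.restrict {β : K | a β = η} (b i)) with hV
  haveI : FiniteDimensional ℝ V := FiniteDimensional.span_of_finite ℝ (Set.finite_range _)
  have hVc : IsClosed (V : Set C({β : K | a β = η}, ℝ)) := V.closed_of_finiteDimensional
  let R : C(K, ℝ) →ₗ[ℝ] C({β : K | a β = η}, ℝ) :=
    { toFun := fun f => f.restrict {β : K | a β = η}
      map_add' := fun f g => by ext; rfl
      map_smul' := fun c f => by ext; rfl }
  have hR : Continuous R := ContinuousMap.continuous_restrict {β : K | a β = η}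
  have hle : Submodule.span ℝ
        {f : C(K, ℝ) | ∃ (k : ℕ) (i : Fin m), f = a ^ k * b i} ≤ V.comap R := by
    rw [Submodule.span_le]
    rintro f ⟨k, i, rfl⟩
    have : R (a ^ k * b i) = η ^ k • ContinuousMap.restrict {β : K | a β = η} (b i) := by
      ext ⟨x, hx⟩
      have hx' : a x = η := hx
      simp [R, hx']
    change R (a ^ k * b i) ∈ V
    rw [this]
    exact V.smul_mem _ (Submodule.subset_span ⟨i, rfl⟩)
  have hcl2 : IsClosed ((V.comap R : Submodule ℝ C(K, ℝ)) : Set C(K, ℝ)) := hVc.preimage hR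
  have htop : ∀ f, f ∈ V.comap R := fun f => by
    have := closure_minimal (SetLike.coe_subset_coe.mpr hle) hcl2 (hd f)
    exact this
  rw [eq_top_iff]
  intro g _
  obtain ⟨f, hf⟩ := ContinuousMap.exists_restrict_eq hcl g
  have := htop f
  rw [← hf]
  exact this

theorem stmt1_bwd (K : Set ℝ) [CompactSpace K]
    (m : ℕ) (a : C(K, ℝ)) (b : Fin m → C(K, ℝ))
    (h : ∀ η ∈ Set.range a,
        Submodule.span ℝ
          (Set.range fun i : Fin m =>
            ContinuousMap.restrict {β : K | a β = η} (b i)) = ⊤) :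
    Dense (↑(Submodule.span ℝ
        {f : C(K, ℝ) | ∃ (k : ℕ) (i : Fin m), f = a ^ k * b i}) : Set C(K, ℝ)) := by
  set L := Submodule.span ℝ
        {f : C(K, ℝ) | ∃ (k : ℕ) (i : Fin m), f = a ^ k * b i} with hL
  have key : ∀ (g : C(ℝ, ℝ)) (i : Fin m), (g.comp a) * b i ∈ L.topologicalClosure := by
    intro g i
    let N : Submodule ℝ C(K, ℝ) := L.topologicalClosure.comap (LinearMap.mulRight ℝ (b i))
    have hN : IsClosed (N : Set C(K, ℝ)) :=
      L.isClosed_topologicalClosure.preimage (continuous_mul_const (b i))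
    have hpow : ∀ k, a ^ k ∈ N := fun k =>
      L.le_topologicalClosure (Submodule.subset_span ⟨k, i, rfl⟩)
    have hpoly : ∀ p : Polynomial ℝ, Polynomial.aeval a p ∈ N := by
      intro p
      rw [Polynomial.aeval_eq_sum_range]
      exact N.sum_mem fun k _ => N.smul_mem _ (hpow k)
    have : g.comp a ∈ closure (N : Set C(K, ℝ)) := by
      rw [Metric.mem_closure_iff]
      intro ε hε
      obtain ⟨p, hp⟩ := exists_polynomial_near_of_continuousOn (-‖a‖) ‖a‖ g
        g.continuous.continuousOn ε hε
      refine ⟨_, hpoly p, ?_⟩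
      rw [ContinuousMap.dist_lt_iff hε]
      intro x
      have hx := hp (a x) (abs_le.mp (a.norm_coe_le_norm x))
      rw [dist_comm, Real.dist_eq]
      simpa [Polynomial.aeval_continuousMap_apply] using hx
    rw [hN.closure_eq] at this
    exact this
  suffices H : ∀ f, f ∈ closure (L.topologicalClosure : Set C(K, ℝ)) by
    intro f
    have := H f
    rwa [L.isClosed_topologicalClosure.closure_eq] at this
  intro f
  rw [Metric.mem_closure_iff]
  intro ε hε
  let t : ℝ → Set (Fin m → ℝ) := fun η => {c | ∀ β, a β = η → f β - ∑ i, c i * b i β ∈ Set.Ioo (-ε) ε}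
  have ht : ∀ x, Convex ℝ (t x) := by
    intro x c hc d hd u v hu hv huv β hβ
    have := (convex_Ioo (-ε) ε) (hc β hβ) (hd β hβ) hu hv huv
    convert this using 1
    simp only [Pi.add_apply, Pi.smul_apply, smul_eq_mul, add_mul, Finset.sum_add_distrib, mul_sub,
      Finset.mul_sum, mul_assoc]
    linear_combination (-f β) * huv
  obtain ⟨g, hg⟩ := exists_continuous_forall_mem_convex_of_local_const ht (by
    intro η
    obtain ⟨c, hc⟩ : ∃ c, c ∈ t η := by
      by_cases hη : η ∈ Set.range a
      · have hm : f.restrict {β : K | a β = η} ∈ Submodule.span ℝ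
          (Set.range fun i : Fin m =>
            ContinuousMap.restrict {β : K | a β = η} (b i)) := by
          rw [h η hη]; trivial
        rw [Submodule.mem_span_range_iff_exists_fun] at hm
        obtain ⟨c, hc⟩ := hm
        refine ⟨c, fun β hβ => ?_⟩
        have := congrArg (fun q => q ⟨β, hβ⟩) hc
        simp [ContinuousMap.sum_apply] at this
        rw [this]
        simpa using hε
      · exact ⟨0, fun β hβ => (hη ⟨β, hβ⟩).elim⟩
    refine ⟨c, ?_⟩
    have hcomp : IsClosed {β : K | f β - ∑ i, c i * b i β ∉ Set.Ioo (-ε) ε} := by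
      have : Continuous fun β : K => f β - ∑ i, c i * b i β := by fun_prop
      exact (isOpen_Ioo.preimage this).isClosed_compl
    have hc2 := (hcomp.isCompact.image a.continuous).isClosed
    have hmem : (a '' {β : K | f β - ∑ i, c i * b i β ∉ Set.Ioo (-ε) ε})ᶜ ∈ nhds η := by
      apply hc2.isOpen_compl.mem_nhds
      rintro ⟨β, hβ, e⟩
      exact hβ (hc β e)
    filter_upwards [hmem] with y hy β hβ
    by_contra hn
    exact hy ⟨β, hn, hβ⟩)
  refine ⟨∑ i, ((⟨fun x => g x i, by fun_prop⟩ : C(ℝ, ℝ)).comp a) * b i,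
    Submodule.sum_mem _ fun i _ => key _ i, ?_⟩
  rw [ContinuousMap.dist_lt_iff hε]
  intro x
  rw [Real.dist_eq, abs_lt]
  have := hg (a x) x rfl
  simpa [ContinuousMap.sum_apply] using this


/-- The multi-input scalar linear ensemble is uniformly ensemble controllable on
`C(K,ℝ)` (i.e. the span of `{a^k·bᵢ : k ∈ ℕ, i = 1,…,m}` is dense in `C(K,ℝ)` w.r.t. the sup
norm) iff for every `η` in the image `a(K)`, the restrictions of `b₁, …, b_m` to the fiber
`a⁻¹(η)` span `C(a⁻¹(η),ℝ)`. -/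
theorem stmt1 (K : Set ℝ) (hK : IsCompact K) (hKne : K.Nonempty)
    (m : ℕ) (a : C(K, ℝ)) (b : Fin m → C(K, ℝ)) :
    Dense (↑(Submodule.span ℝ
        {f : C(K, ℝ) | ∃ (k : ℕ) (i : Fin m), f = a ^ k * b i}) : Set C(K, ℝ)) ↔
      ∀ η ∈ Set.range a,
        Submodule.span ℝ
          (Set.range fun i : Fin m =>
            ContinuousMap.restrict {β : K | a β = η} (b i)) = ⊤ := by
  haveI : CompactSpace K := isCompact_iff_compactSpace.mp hK
  exact ⟨fun hd η _ => stmt1_fwd K m a b hd η, stmt1_bwd K m a b⟩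
end

section
/- Let K ⊂ ℝ be a nonempty compact set and let a, b₁, …, b_m ∈ C(K,ℝ). The linear span L₀ = span{β ↦ a(β)^k b_i(β) : k ∈ ℕ, 1 ≤ i ≤ m} is dense in C(K,ℝ) with respect to the supremum norm if and only if, for every η in the image a(K), the fiber a⁻¹(η) = {β ∈ K : a(β) = η} is finite, with cardinality κ(η) ≤ m, and the κ(η) × m real matrix D(η) — the Ensemble Controllability Gramian — whose rows are indexed by the points β of a⁻¹(η) and whose (β,i) entry equals b_i(β), has rank κ(η). -/
theorem aux_poly {X : Type*} [TopologicalSpace X] {m : ℕ} (a : C(X, ℝ)) (b : Fin m → C(X, ℝ))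
    (p : Polynomial ℝ) (i : Fin m) :
    Polynomial.aeval a p * b i ∈ Submodule.span ℝ
        {f : C(X, ℝ) | ∃ (k : ℕ) (i : Fin m), f = a ^ k * b i} := by
  induction p using Polynomial.induction_on' with
  | add p q hp hq => rw [map_add, add_mul]; exact add_mem hp hq
  | monomial n c =>
    rw [Polynomial.aeval_monomial, ← Algebra.smul_def, smul_mul_assoc]
    exact Submodule.smul_mem _ _ (Submodule.subset_span ⟨n, i, rfl⟩)

theorem aux_comp {X : Type*} [TopologicalSpace X] [CompactSpace X] {m : ℕ} (a : C(X, ℝ))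
    (b : Fin m → C(X, ℝ)) (g : C(ℝ, ℝ)) (i : Fin m) :
    (g.comp a) * b i ∈ (Submodule.span ℝ
        {f : C(X, ℝ) | ∃ (k : ℕ) (i : Fin m), f = a ^ k * b i}).topologicalClosure := by
  rw [← SetLike.mem_coe, Submodule.topologicalClosure_coe, Metric.mem_closure_iff]
  intro ε hε
  have hd : 0 < ε / (2 * (‖b i‖ + 1)) := by positivity
  obtain ⟨p, hp⟩ := exists_polynomial_near_of_continuousOn (-‖a‖) ‖a‖ g g.continuous.continuousOn _ hd
  refine ⟨_, aux_poly a b p i, ?_⟩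
  rw [dist_eq_norm, ← sub_mul]
  have h1 : ‖g.comp a - Polynomial.aeval a p‖ ≤ ε / (2 * (‖b i‖ + 1)) := by
    rw [ContinuousMap.norm_le _ hd.le]
    intro x
    have hx := hp (a x) (abs_le.1 (a.norm_coe_le_norm x))
    rw [abs_sub_comm] at hx
    have : (Polynomial.aeval a p) x = p.eval (a x) := by
      exact Polynomial.aeval_continuousMap_apply p a x
    simp only [ContinuousMap.sub_apply, this, ContinuousMap.comp_apply]
    exact hx.le
  calc _ ≤ _ := norm_mul_le _ _
    _ ≤ ε / (2 * (‖b i‖ + 1)) * (‖b i‖ + 1) := by gcongr; linarith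
    _ = ε / 2 := by field_simp
    _ < ε := by linarith

theorem aux_suff {X : Type*} [TopologicalSpace X] [CompactSpace X] {m : ℕ} (a : C(X, ℝ))
    (b : Fin m → C(X, ℝ))
    (h : ∀ (f : C(X, ℝ)) (y : ℝ), ∃ c : Fin m → ℝ, ∀ x, a x = y → f x = ∑ i, c i * b i x) :
    Dense (↑(Submodule.span ℝ
        {f : C(X, ℝ) | ∃ (k : ℕ) (i : Fin m), f = a ^ k * b i}) : Set C(X, ℝ)) := by
  intro f
  rw [← Submodule.topologicalClosure_coe, ← (Submodule.isClosed_topologicalClosure _).closure_eq,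
    Metric.mem_closure_iff]
  intro ε hε
  obtain ⟨g, hg⟩ := exists_continuous_forall_mem_convex_of_local_const
    (t := fun y : ℝ => {c : Fin m → ℝ | ∀ x, a x = y → |f x - ∑ i, c i * b i x| < ε})
    (by
      intro y c hc d hd s t hs ht hst x hx
      have h1 := hc x hx
      have h2 := hd x hx
      have : f x - ∑ i, (s • c + t • d) i * b i x =
          s * (f x - ∑ i, c i * b i x) + t * (f x - ∑ i, d i * b i x) := by
        have h3 : ∑ i, (s • c + t • d) i * b i x =
          s * (∑ i, c i * b i x) + t * (∑ i, d i * b i x) := by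
          rw [Finset.mul_sum, Finset.mul_sum, ← Finset.sum_add_distrib]
          refine Finset.sum_congr rfl fun i _ => ?_
          simp only [Pi.add_apply, Pi.smul_apply, smul_eq_mul]; ring
        rw [h3]
        linear_combination (-f x) * hst
      rw [this]
      have := convex_ball (0 : ℝ) ε (x := f x - ∑ i, c i * b i x) (by simpa using h1)
        (y := f x - ∑ i, d i * b i x) (by simpa using h2) hs ht hst
      simpa using this)
    (by
      intro y
      obtain ⟨c, hc⟩ := h f y
      refine ⟨c, ?_⟩
      have hcl : IsClosed {x : X | ε ≤ |f x - ∑ i, c i * b i x|} :=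
        isClosed_le continuous_const (by fun_prop)
      have hcl2 := (hcl.isCompact.image a.continuous).isClosed
      have hy : y ∈ (a '' {x : X | ε ≤ |f x - ∑ i, c i * b i x|})ᶜ := by
        rintro ⟨x, hx, hxy⟩
        have := hc x hxy
        simp only [Set.mem_setOf_eq, this, sub_self, abs_zero] at hx
        linarith
      filter_upwards [hcl2.isOpen_compl.mem_nhds hy] with z hz x hx
      by_contra hn
      exact hz ⟨x, not_lt.1 hn, hx⟩)
  refine ⟨∑ i, ((ContinuousMap.comp ⟨fun y => g y i, by fun_prop⟩ a) * b i),
    Submodule.sum_mem _ fun i _ => aux_comp a b _ i, ?_⟩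
  rw [ContinuousMap.dist_lt_iff hε]
  intro x
  have := hg (a x) x rfl
  rw [Real.dist_eq]
  simpa using this

theorem aux_nec {K : Set ℝ} [CompactSpace K] {m : ℕ} (a : C(K, ℝ)) (b : Fin m → C(K, ℝ))
    (h : Dense (↑(Submodule.span ℝ
        {f : C(K, ℝ) | ∃ (k : ℕ) (i : Fin m), f = a ^ k * b i}) : Set C(K, ℝ))) (η : ℝ) :
    LinearIndependent ℝ (fun (β : {β : K | a β = η}) (i : Fin m) => b i β.1) := by
  rw [linearIndependent_iff']
  intro s c hc β₀ hβ₀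
  have hz : ∀ f : C(K, ℝ), ∑ β ∈ s, c β * f β.1 = 0 := by
    have hcl : IsClosed {f : C(K, ℝ) | ∑ β ∈ s, c β * f β.1 = 0} :=
      isClosed_eq (continuous_finsetSum _ fun β _ =>
        continuous_const.mul (continuous_eval_const β.1)) continuous_const
    have hsub : (↑(Submodule.span ℝ
        {f : C(K, ℝ) | ∃ (k : ℕ) (i : Fin m), f = a ^ k * b i}) : Set C(K, ℝ)) ⊆
        {f : C(K, ℝ) | ∑ β ∈ s, c β * f β.1 = 0} := by
      intro f hf
      induction hf using Submodule.span_induction with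
      | mem f hf =>
        obtain ⟨k, i, rfl⟩ := hf
        have h1 := congrFun hc i
        simp only [Finset.sum_apply, Pi.smul_apply, smul_eq_mul, Pi.zero_apply] at h1
        have : ∑ β ∈ s, c β * (a ^ k * b i) β.1 = η ^ k * ∑ β ∈ s, c β * b i β.1 := by
          rw [Finset.mul_sum]
          refine Finset.sum_congr rfl fun β _ => ?_
          have hb : a β.1 = η := β.2
          simp only [ContinuousMap.mul_apply, ContinuousMap.pow_apply, hb]; ring
        rw [Set.mem_setOf_eq, this, h1, mul_zero]
      | zero => simp
      | add f g _ _ hf hg =>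
        simp only [Set.mem_setOf_eq, ContinuousMap.add_apply, mul_add,
          Finset.sum_add_distrib] at *
        rw [hf, hg, add_zero]
      | smul r f _ hf =>
        simp only [Set.mem_setOf_eq, ContinuousMap.smul_apply, smul_eq_mul] at *
        have : ∑ β ∈ s, c β * (r * f β.1) = r * ∑ β ∈ s, c β * f β.1 := by
          rw [Finset.mul_sum]
          exact Finset.sum_congr rfl fun β _ => by ring
        rw [this, hf, mul_zero]
    intro f
    exact hcl.closure_subset_iff.2 hsub (h f)
  classical
  have h2 := hz ⟨fun x => ∏ β ∈ s.erase β₀, ((x : ℝ) - (β.1 : ℝ)), by fun_prop⟩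
  rw [Finset.sum_eq_single β₀] at h2
  · simp only [ContinuousMap.coe_mk, mul_eq_zero] at h2
    refine h2.resolve_right (Finset.prod_ne_zero_iff.2 fun β hβ => ?_)
    rw [sub_ne_zero]
    intro he
    exact (Finset.ne_of_mem_erase hβ) (Subtype.ext (Subtype.ext he.symm))
  · intro β hβ hne
    simp only [ContinuousMap.coe_mk]
    rw [Finset.prod_eq_zero (Finset.mem_erase.2 ⟨hne, hβ⟩) (sub_self _), mul_zero]
  · intro hn; exact absurd hβ₀ hn

/-- The multi-input scalar linear ensemble is uniformly ensemble controllable on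
`C(K,ℝ)` (density of the span of `{a^k·bᵢ}`) iff for every `η ∈ a(K)` the fiber `a⁻¹(η)` is
finite with cardinality `κ(η) ≤ m` and the `κ(η) × m` Ensemble Controllability Gramian `D(η)`,
with `(β,i)` entry `bᵢ(β)` for `β ∈ a⁻¹(η)`, has rank `κ(η)`. -/
theorem stmt2 (K : Set ℝ) (hK : IsCompact K) (hKne : K.Nonempty)
    (m : ℕ) (a : C(K, ℝ)) (b : Fin m → C(K, ℝ)) :
    Dense (↑(Submodule.span ℝ
        {f : C(K, ℝ) | ∃ (k : ℕ) (i : Fin m), f = a ^ k * b i}) : Set C(K, ℝ)) ↔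
      ∀ η ∈ Set.range a,
        {β : K | a β = η}.Finite ∧
        {β : K | a β = η}.ncard ≤ m ∧
        Matrix.rank
            (Matrix.of fun (β : {β : K | a β = η}) (i : Fin m) => b i β.1) =
          {β : K | a β = η}.ncard := by
  haveI : CompactSpace K := isCompact_iff_compactSpace.1 hK
  constructor
  · intro h η _
    have hli := aux_nec a b h η
    have hfin : Finite {β : K | a β = η} := hli.finite
    haveI := Fintype.ofFinite {β : K | a β = η}
    have hcard : {β : K | a β = η}.ncard = Fintype.card {β : K | a β = η} := by
      rw [← Nat.card_coe_set_eq, Nat.card_eq_fintype_card]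
    refine ⟨Set.toFinite _, ?_, ?_⟩
    · rw [hcard]
      simpa using hli.fintype_card_le_finrank
    · rw [hcard]
      exact LinearIndependent.rank_matrix hli
  · intro h
    apply aux_suff
    intro f y
    by_cases hy : y ∈ Set.range a
    · obtain ⟨hfin, -, hr⟩ := h y hy
      haveI := hfin.fintype
      have hcard : {β : K | a β = y}.ncard = Fintype.card {β : K | a β = y} := by
        rw [← Nat.card_coe_set_eq, Nat.card_eq_fintype_card]
      rw [hcard] at hr
      have htop : LinearMap.range (Matrix.mulVecLin
          (Matrix.of fun (β : {β : K | a β = y}) (i : Fin m) => b i β.1)) = ⊤ := by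
        apply Submodule.eq_top_of_finrank_eq
        rw [Module.finrank_fintype_fun_eq_card]
        exact hr
      obtain ⟨c, hc⟩ := LinearMap.range_eq_top.1 htop (fun β => f β.1)
      refine ⟨c, fun x hx => ?_⟩
      have h3 := congrFun hc ⟨x, hx⟩
      simp only [Matrix.mulVecLin_apply, Matrix.mulVec, dotProduct, Matrix.of_apply] at h3
      rw [← h3]
      exact Finset.sum_congr rfl fun i _ => mul_comm _ _
    · exact ⟨0, fun x hx => absurd ⟨x, hx⟩ hy⟩
end

section
/- Let K ⊂ ℝ be a nonempty compact set, let λ₁, λ₂ ∈ C(K,ℝ) be injective, and let b̃₁, b̃₂ : K → ℝ^{1×m} be continuous with b̃₁(β) ≠ 0 and b̃₂(β) ≠ 0 for all β ∈ K. Write Λ(β) = diag(λ₁(β), λ₂(β)) and let B̃(β) be the 2×m matrix with rows b̃₁(β), b̃₂(β). Then the linear span of the functions β ↦ Λ(β)^k B̃(β)u, over k ∈ ℕ and u ∈ ℝ^m, is dense in C(K,ℝ²) with respect to the supremum norm if and only if for every pair (β₁, β₂) ∈ K × K, the matrix pair (diag(λ₁(β₁), λ₂(β₂)), M(β₁,β₂))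 is controllable on ℝ², where M(β₁,β₂) ∈ ℝ^{2×m} has first row b̃₁(β₁) and second row b̃₂(β₂). -/
/-- A matrix pair `(A, B)` is controllable on `ℝ^N` (Kalman rank condition):
`span{A^k B u : k ∈ ℕ, u ∈ ℝ^m} = ℝ^N`. -/
def IsControllablePair {N m : ℕ} (A : Matrix (Fin N) (Fin N) ℝ)
    (B : Matrix (Fin N) (Fin m) ℝ) : Prop :=
  Submodule.span ℝ
    {v : Fin N → ℝ | ∃ (k : ℕ) (u : Fin m → ℝ), v = (A ^ k * B).mulVec u} = ⊤

lemma gen_eval {m : ℕ} (a b : ℝ) (r s u : Fin m → ℝ) (k : ℕ) :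
    ((Matrix.diagonal ![a, b]) ^ k * Matrix.of ![r, s]).mulVec u
      = ![a ^ k * (r ⬝ᵥ u), b ^ k * (s ⬝ᵥ u)] := by
  rw [← Matrix.mulVec_mulVec, Matrix.diagonal_pow]
  ext i
  fin_cases i <;> simp [Matrix.mulVec_diagonal, Matrix.mulVec]

lemma exists_dot {m : ℕ} (r : Fin m → ℝ) (hr : r ≠ 0) (c : ℝ) : ∃ u : Fin m → ℝ, r ⬝ᵥ u = c := by
  have h : r ⬝ᵥ r ≠ 0 := fun h => hr (dotProduct_self_eq_zero.1 h)
  refine ⟨(c / (r ⬝ᵥ r)) • r, ?_⟩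
  rw [dotProduct_smul, smul_eq_mul]
  field_simp

lemma exists_dot2 {m : ℕ} (s0 : ℝ) (r s : Fin m → ℝ)
    (h : IsControllablePair (Matrix.diagonal ![s0, s0]) (Matrix.of ![r, s])) (c d : ℝ) :
    ∃ u : Fin m → ℝ, r ⬝ᵥ u = c ∧ s ⬝ᵥ u = d := by
  unfold IsControllablePair at h
  have hle : Submodule.span ℝ
    {v : Fin 2 → ℝ | ∃ (k : ℕ) (u : Fin m → ℝ), v =
      ((Matrix.diagonal ![s0, s0]) ^ k * (Matrix.of ![r, s])).mulVec u} ≤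
      LinearMap.range (Matrix.mulVecLin (Matrix.of ![r, s])) := by
    rw [Submodule.span_le]
    rintro v ⟨k, u, rfl⟩
    refine ⟨s0 ^ k • u, ?_⟩
    rw [gen_eval]
    ext i
    fin_cases i <;> simp [Matrix.mulVec]
  rw [h] at hle
  obtain ⟨u, hu⟩ := hle (Submodule.mem_top (x := ![c, d]))
  refine ⟨u, ?_, ?_⟩
  · simpa [Matrix.mulVec] using congrFun hu 0
  · simpa [Matrix.mulVec] using congrFun hu 1

lemma local_near {X : Type*} [TopologicalSpace X] [CompactSpace X] (lam g : C(X, ℝ)) (ε : ℝ)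
    (s0 : ℝ) (h : ∀ x, lam x = s0 → |g x| < ε) :
    ∀ᶠ s in nhds s0, ∀ x, lam x = s → |g x| < ε := by
  have hc : IsClosed {x | ε ≤ |g x|} := isClosed_le continuous_const (by fun_prop)
  have hi : IsClosed (lam '' {x | ε ≤ |g x|}) := (hc.isCompact.image lam.continuous).isClosed
  have hm : s0 ∈ (lam '' {x | ε ≤ |g x|})ᶜ := by
    rintro ⟨x, hx, hx'⟩
    exact absurd (h x hx') (not_lt.2 hx)
  filter_upwards [hi.isOpen_compl.mem_nhds hm] with s hs x hx
  by_contra hn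
  exact hs ⟨x, not_lt.1 hn, hx⟩

theorem stmt3 (K : Set ℝ) (hK : IsCompact K) (hKne : K.Nonempty) (m : ℕ)
    (lam1 lam2 : C(K, ℝ))
    (hlam1 : Function.Injective lam1) (hlam2 : Function.Injective lam2)
    (b1 b2 : K → Fin m → ℝ) (hb1 : Continuous b1) (hb2 : Continuous b2)
    (hb1ne : ∀ β : K, b1 β ≠ 0) (hb2ne : ∀ β : K, b2 β ≠ 0) :
    Dense (↑(Submodule.span ℝ
        {f : C(K, Fin 2 → ℝ) | ∃ (k : ℕ) (u : Fin m → ℝ), ∀ β : K,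
          f β = ((Matrix.diagonal ![lam1 β, lam2 β]) ^ k *
            Matrix.of ![b1 β, b2 β]).mulVec u}) : Set C(K, Fin 2 → ℝ)) ↔
      ∀ β1 β2 : K,
        IsControllablePair (Matrix.diagonal ![lam1 β1, lam2 β2])
          (Matrix.of ![b1 β1, b2 β2]) := by
  haveI : CompactSpace K := isCompact_iff_compactSpace.1 hK
  constructor
  · intro hd β1 β2
    unfold IsControllablePair
    set W := Submodule.span ℝ
      {v : Fin 2 → ℝ | ∃ (k : ℕ) (u : Fin m → ℝ), v =
        ((Matrix.diagonal ![lam1 β1, lam2 β2]) ^ k * (Matrix.of ![b1 β1, b2 β2])).mulVec u} with hW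
    let E : C(K, Fin 2 → ℝ) →ₗ[ℝ] (Fin 2 → ℝ) :=
      { toFun := fun f => ![f β1 0, f β2 1]
        map_add' := by intro f g; ext i; fin_cases i <;> simp
        map_smul' := by intro c f; ext i; fin_cases i <;> simp }
    have hE : Continuous E := by
      change Continuous (fun f : C(K, Fin 2 → ℝ) => ![f β1 0, f β2 1])
      refine continuous_pi fun i => ?_
      fin_cases i
      · change Continuous (fun g : C(K, Fin 2 → ℝ) => g β1 0)
        fun_prop
      · change Continuous (fun g : C(K, Fin 2 → ℝ) => g β2 1)
        fun_prop
    have hcl : IsClosed ((W.comap E : Submodule ℝ _) : Set C(K, Fin 2 → ℝ)) :=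
      (Submodule.closed_of_finiteDimensional W).preimage hE
    have hle : Submodule.span ℝ
        {f : C(K, Fin 2 → ℝ) | ∃ (k : ℕ) (u : Fin m → ℝ), ∀ β : K,
          f β = ((Matrix.diagonal ![lam1 β, lam2 β]) ^ k *
            Matrix.of ![b1 β, b2 β]).mulVec u} ≤ W.comap E := by
      rw [Submodule.span_le]
      rintro f ⟨k, u, hf⟩
      refine Submodule.subset_span ⟨k, u, ?_⟩
      rw [gen_eval]
      change ![f β1 0, f β2 1] = _
      rw [hf β1, hf β2, gen_eval, gen_eval]
      simp
    have huniv := (hd.mono hle).closure_eq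
    rw [hcl.closure_eq] at huniv
    rw [eq_top_iff]
    intro v _
    have : ContinuousMap.const K v ∈ ((W.comap E : Submodule ℝ _) : Set C(K, Fin 2 → ℝ)) := by
      rw [huniv]; trivial
    have h2 : E (ContinuousMap.const K v) ∈ W := this
    have h3 : E (ContinuousMap.const K v) = v := by
      ext i; fin_cases i <;> simp [E]
    rwa [h3] at h2
  · intro hc
    set V := Submodule.span ℝ
        {f : C(K, Fin 2 → ℝ) | ∃ (k : ℕ) (u : Fin m → ℝ), ∀ β : K,
          f β = ((Matrix.diagonal ![lam1 β, lam2 β]) ^ k *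
            Matrix.of ![b1 β, b2 β]).mulVec u} with hV
    have hcont : ∀ (p : Polynomial ℝ) (u : Fin m → ℝ), Continuous (fun β : K =>
        ![p.eval (lam1 β) * (b1 β ⬝ᵥ u), p.eval (lam2 β) * (b2 β ⬝ᵥ u)]) := by
      intro p u
      refine continuous_pi fun i => ?_
      fin_cases i
      · exact (p.continuous.comp lam1.continuous).mul (hb1.dotProduct continuous_const)
      · exact (p.continuous.comp lam2.continuous).mul (hb2.dotProduct continuous_const)
    have hmem : ∀ (p : Polynomial ℝ) (u : Fin m → ℝ),
        (⟨_, hcont p u⟩ : C(K, Fin 2 → ℝ)) ∈ V := by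
      intro p u
      induction p using Polynomial.induction_on' with
      | add p q hp hq =>
        convert V.add_mem hp hq using 1
        ext β i
        fin_cases i <;> simp [add_mul]
      | monomial k a =>
        have : (⟨_, hcont (Polynomial.monomial k 1) u⟩ : C(K, Fin 2 → ℝ)) ∈ V := by
          refine Submodule.subset_span ⟨k, u, fun β => ?_⟩
          rw [gen_eval]
          simp
        convert V.smul_mem a this using 1
        ext β i
        fin_cases i <;> simp [mul_assoc]
    rw [Metric.dense_iff]
    intro f ε hε
    let f1 : C(K, ℝ) := ⟨fun β => f β 0, (continuous_apply 0).comp f.continuous⟩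
    let f2 : C(K, ℝ) := ⟨fun β => f β 1, (continuous_apply 1).comp f.continuous⟩
    let t : ℝ → Set (Fin m → ℝ) := fun s =>
      {u | (∀ β, lam1 β = s → |b1 β ⬝ᵥ u - f β 0| < ε / 4) ∧
        (∀ β, lam2 β = s → |b2 β ⬝ᵥ u - f β 1| < ε / 4)}
    have hconv1 : ∀ (r : Fin m → ℝ) (c : ℝ), Convex ℝ {u : Fin m → ℝ | |r ⬝ᵥ u - c| < ε / 4} := by
      intro r c u hu v hv a b ha hb hab
      simp only [Set.mem_ofPred_eq, dotProduct_add, dotProduct_smul, smul_eq_mul, abs_lt] at *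
      have hb' : b = 1 - a := by linarith
      subst hb'
      have i1 : -(ε / 4) < a * (r ⬝ᵥ u - c) + (1 - a) * (r ⬝ᵥ v - c) :=
        convex_Ioi (𝕜 := ℝ) (-(ε / 4)) hu.1 hv.1 ha hb hab
      have i2 : a * (r ⬝ᵥ u - c) + (1 - a) * (r ⬝ᵥ v - c) < ε / 4 :=
        convex_Iio (𝕜 := ℝ) (ε / 4) hu.2 hv.2 ha hb hab
      constructor <;> linarith
    have htconv : ∀ s, Convex ℝ (t s) := by
      intro s u hu v hv a b ha hb hab
      exact ⟨fun β h => hconv1 _ _ (hu.1 β h) (hv.1 β h) ha hb hab,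
        fun β h => hconv1 _ _ (hu.2 β h) (hv.2 β h) ha hb hab⟩
    have hloc : ∀ s0 : ℝ, ∃ u : Fin m → ℝ, ∀ᶠ s in nhds s0, u ∈ t s := by
      intro s0
      obtain ⟨u, hu1, hu2⟩ : ∃ u : Fin m → ℝ, (∀ β, lam1 β = s0 → b1 β ⬝ᵥ u = f β 0) ∧
          (∀ β, lam2 β = s0 → b2 β ⬝ᵥ u = f β 1) := by
        by_cases h1 : ∃ β, lam1 β = s0
        · obtain ⟨β1, e1⟩ := h1
          by_cases h2 : ∃ β, lam2 β = s0
          · obtain ⟨β2, e2⟩ := h2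
            have h := hc β1 β2
            rw [e1, e2] at h
            obtain ⟨u, h1, h2⟩ := exists_dot2 s0 _ _ h (f β1 0) (f β2 1)
            refine ⟨u, fun β hβ => ?_, fun β hβ => ?_⟩
            · rw [hlam1 (hβ.trans e1.symm), h1]
            · rw [hlam2 (hβ.trans e2.symm), h2]
          · obtain ⟨u, h1⟩ := exists_dot _ (hb1ne β1) (f β1 0)
            refine ⟨u, fun β hβ => ?_, fun β hβ => (h2 ⟨β, hβ⟩).elim⟩
            rw [hlam1 (hβ.trans e1.symm), h1]
        · by_cases h2 : ∃ β, lam2 β = s0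
          · obtain ⟨β2, e2⟩ := h2
            obtain ⟨u, h2⟩ := exists_dot _ (hb2ne β2) (f β2 1)
            refine ⟨u, fun β hβ => (h1 ⟨β, hβ⟩).elim, fun β hβ => ?_⟩
            rw [hlam2 (hβ.trans e2.symm), h2]
          · exact ⟨0, fun β hβ => (h1 ⟨β, hβ⟩).elim, fun β hβ => (h2 ⟨β, hβ⟩).elim⟩
      refine ⟨u, ?_⟩
      have A := local_near lam1 (⟨fun β => b1 β ⬝ᵥ u, hb1.dotProduct continuous_const⟩ - f1)
        (ε / 4) s0 (by intro x hx; simp [f1, hu1 x hx, hε])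
      have B := local_near lam2 (⟨fun β => b2 β ⬝ᵥ u, hb2.dotProduct continuous_const⟩ - f2)
        (ε / 4) s0 (by intro x hx; simp [f2, hu2 x hx, hε])
      filter_upwards [A, B] with s hA hB
      exact ⟨hA, hB⟩
    obtain ⟨U, hU⟩ := exists_continuous_forall_mem_convex_of_local_const htconv hloc
    -- bounds
    obtain ⟨R1, hR1⟩ := (isCompact_range lam1.continuous).isBounded.subset_closedBall 0
    obtain ⟨R2, hR2⟩ := (isCompact_range lam2.continuous).isBounded.subset_closedBall 0
    obtain ⟨C1, hC1⟩ := (isCompact_range hb1).isBounded.subset_closedBall 0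
    obtain ⟨C2, hC2⟩ := (isCompact_range hb2).isBounded.subset_closedBall 0
    set R := max R1 R2
    set C := max (max C1 C2) 0
    have hC0 : 0 ≤ C := le_max_right _ _
    have hl1 : ∀ β, lam1 β ∈ Set.Icc (-R) R := fun β => by
      have := hR1 ⟨β, rfl⟩
      rw [mem_closedBall_zero_iff, Real.norm_eq_abs] at this
      exact abs_le.1 (this.trans (le_max_left _ _))
    have hl2 : ∀ β, lam2 β ∈ Set.Icc (-R) R := fun β => by
      have := hR2 ⟨β, rfl⟩
      rw [mem_closedBall_zero_iff, Real.norm_eq_abs] at this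
      exact abs_le.1 (this.trans (le_max_right _ _))
    have hn1 : ∀ β j, |b1 β j| ≤ C := fun β j => by
      have := hC1 ⟨β, rfl⟩
      rw [mem_closedBall_zero_iff] at this
      exact (norm_le_pi_norm (b1 β) j).trans
        (this.trans ((le_max_left _ _).trans (le_max_left _ _)))
    have hn2 : ∀ β j, |b2 β j| ≤ C := fun β j => by
      have := hC2 ⟨β, rfl⟩
      rw [mem_closedBall_zero_iff] at this
      exact (norm_le_pi_norm (b2 β) j).trans
        (this.trans ((le_max_right _ _).trans (le_max_left _ _)))
    set δ := ε / (4 * (m * C + 1)) with hδ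
    have hmC : 0 < (m : ℝ) * C + 1 := by positivity
    have hδ0 : 0 < δ := by positivity
    have hδm : m * (C * δ) ≤ ε / 4 := by
      have : (m * C + 1) * δ = ε / 4 := by rw [hδ]; field_simp
      nlinarith
    choose p hp using fun j : Fin m => exists_polynomial_near_of_continuousOn (-R) R
      (fun s => U s j) ((continuous_apply j).comp U.continuous).continuousOn δ hδ0
    have key : ∀ (r : Fin m → ℝ) (s c : ℝ), s ∈ Set.Icc (-R) R → (∀ j, |r j| ≤ C) →
        |r ⬝ᵥ U s - c| < ε / 4 → |(∑ j, (p j).eval s * r j) - c| ≤ ε / 2 := by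
      intro r s c hs hr hc
      have h1 : |(∑ j, (p j).eval s * r j) - r ⬝ᵥ U s| ≤ m * (C * δ) := by
        rw [dotProduct, ← Finset.sum_sub_distrib]
        refine (Finset.abs_sum_le_sum_abs _ _).trans ?_
        calc _ ≤ ∑ j : Fin m, C * δ := by
              refine Finset.sum_le_sum fun j _ => ?_
              rw [show (p j).eval s * r j - r j * U s j = r j * ((p j).eval s - U s j) by ring,
                abs_mul]
              exact mul_le_mul (hr j) (hp j s hs).le (abs_nonneg _) hC0
          _ = _ := by simp
      have := abs_sub_le (∑ j, (p j).eval s * r j) (r ⬝ᵥ U s) c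
      linarith
    refine ⟨∑ j, (⟨_, hcont (p j) (Pi.single j 1)⟩ : C(K, Fin 2 → ℝ)), ?_,
      V.sum_mem fun j _ => hmem _ _⟩
    rw [Metric.mem_ball]
    refine lt_of_le_of_lt ?_ (half_lt_self hε)
    rw [ContinuousMap.dist_le (by positivity)]
    intro β
    rw [dist_pi_le_iff (by positivity)]
    intro i
    rw [Real.dist_eq]
    fin_cases i
    · have := key (b1 β) (lam1 β) (f β 0) (hl1 β) (hn1 β) ((hU (lam1 β)).1 β rfl)
      simpa using this
    · have := key (b2 β) (lam2 β) (f β 1) (hl2 β) (hn2 β) ((hU (lam2 β)).2 β rfl)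
      simpa using this
end

section
/- Let K ⊂ ℝ be a nonempty compact set. Let A : K → ℝ^{n×n} and B : K → ℝ^{n×m} be continuous, and suppose there are a continuous map P : K → GL(n,ℝ) and continuous injective functions λ₁, …, λₙ ∈ C(K,ℝ) such that A(β) = P(β) Λ(β) P(β)⁻¹ for all β ∈ K, where Λ(β) = diag(λ₁(β), …, λₙ(β)). Let B̃(β) = P(β)⁻¹ B(β) with rows b̃₁(β), …, b̃ₙ(β) ∈ ℝ^{1×m}. Then the linear span of the functions β ↦ A(β)^k B(β)u, over k ∈ ℕ and u ∈ ℝ^m, is dense in C(K,ℝⁿ) with respect to the supremum norm if and only if for every n-tuple (β₁, …, βₙ) ∈ Kⁿ, the matrix pair (diag(λ₁(β₁), …, λₙ(βₙ)), M) is controllable on ℝⁿ, where M ∈ ℝ^{n×m} is the matrix whose i-th row is b̃ᵢ(βᵢ). -/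
open Matrix in
lemma aux_inv_cont {X : Type*} [TopologicalSpace X] {n : ℕ} (P : X → Matrix (Fin n) (Fin n) ℝ)
    (hP : Continuous P) (h : ∀ x, IsUnit (P x)) : Continuous fun x => (P x)⁻¹ := by
  simp only [Matrix.inv_def, Ring.inverse_eq_inv']
  have h1 : Continuous fun x => (P x).det⁻¹ :=
    Continuous.inv₀ hP.matrix_det fun x => ((Matrix.isUnit_iff_isUnit_det _).1 (h x)).ne_zero
  exact h1.smul hP.matrix_adjugate

lemma aux_pow {n m : ℕ} (A P : Matrix (Fin n) (Fin n) ℝ) (B : Matrix (Fin n) (Fin m) ℝ)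
    (d : Fin n → ℝ) (hP : IsUnit P) (h : A = P * Matrix.diagonal d * P⁻¹) (k : ℕ) :
    A ^ k * B = P * (Matrix.diagonal (fun i => d i ^ k) * (P⁻¹ * B)) := by
  have hd := (Matrix.isUnit_iff_isUnit_det _).1 hP
  have : A ^ k = P * Matrix.diagonal (fun i => d i ^ k) * P⁻¹ := by
    induction k with
    | zero => simp [Matrix.mul_nonsing_inv _ hd]
    | succ k ih =>
      rw [pow_succ, ih, h]
      calc _ = P * Matrix.diagonal (fun i => d i ^ k) * (P⁻¹ * P) * Matrix.diagonal d * P⁻¹ := by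
            simp only [Matrix.mul_assoc]
        _ = _ := by
            rw [Matrix.nonsing_inv_mul _ hd, Matrix.mul_one, Matrix.mul_assoc P,
              Matrix.diagonal_mul_diagonal]
            simp only [pow_succ]
  rw [this]; simp only [Matrix.mul_assoc]

lemma aux_diag {n m : ℕ} (d : Fin n → ℝ) (M : Matrix (Fin n) (Fin m) ℝ) (u : Fin m → ℝ) (i : Fin n) :
    (Matrix.diagonal d * M).mulVec u i = d i * M.mulVec u i := by
  rw [← Matrix.mulVec_mulVec, Matrix.mulVec_diagonal]

/-- multiplication by a continuous matrix function -/
noncomputable def mulC {X : Type*} [TopologicalSpace X] {n : ℕ}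
    (P : X → Matrix (Fin n) (Fin n) ℝ) (hP : Continuous P) :
    C(X, Fin n → ℝ) →ₗ[ℝ] C(X, Fin n → ℝ) where
  toFun f := ⟨fun x => (P x).mulVec (f x), hP.matrix_mulVec f.continuous⟩
  map_add' f g := by ext x; simp [Matrix.mulVec_add]
  map_smul' c f := by ext x; simp [Matrix.mulVec_smul]

lemma mulC_cont {X : Type*} [TopologicalSpace X] [LocallyCompactSpace X] {n : ℕ}
    (P : X → Matrix (Fin n) (Fin n) ℝ) (hP : Continuous P) : Continuous (mulC P hP) := by
  apply ContinuousMap.continuous_of_continuous_uncurry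
  exact (hP.comp continuous_snd).matrix_mulVec
    (continuous_eval : Continuous fun p : C(X, Fin n → ℝ) × X => p.1 p.2)

/-- column `j` times a function of the eigenvalues -/
noncomputable def colC {X : Type*} [TopologicalSpace X] {n m : ℕ} {s : Set ℝ}
    (M : X → Matrix (Fin n) (Fin m) ℝ) (hM : Continuous M) (j : Fin m) (l : Fin n → C(X, s)) :
    C(s, ℝ) →ₗ[ℝ] C(X, Fin n → ℝ) where
  toFun g := ⟨fun x i => g (l i x) * M x i j,
    continuous_pi fun i => (g.continuous.comp (l i).continuous).mul (hM.matrix_elem i j)⟩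
  map_add' f g := by ext x; simp [add_mul]
  map_smul' c f := by ext x; simp [mul_assoc]

lemma colC_cont {X : Type*} [TopologicalSpace X] [LocallyCompactSpace X] {n m : ℕ} {s : Set ℝ}
    [LocallyCompactSpace s]
    (M : X → Matrix (Fin n) (Fin m) ℝ) (hM : Continuous M) (j : Fin m) (l : Fin n → C(X, s)) :
    Continuous (colC M hM j l) := by
  apply ContinuousMap.continuous_of_continuous_uncurry
  refine continuous_pi fun i => ?_
  have h1 : Continuous fun p : C(s, ℝ) × X => p.1 (l i p.2) :=
    (continuous_eval : Continuous fun p : C(s, ℝ) × s => p.1 p.2).comp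
      (continuous_fst.prodMk ((l i).continuous.comp continuous_snd))
  exact h1.mul ((hM.matrix_elem i j).comp continuous_snd)

/-- the dense span argument for polynomials -/
lemma colC_mem {X : Type*} [TopologicalSpace X] [LocallyCompactSpace X] {n m : ℕ} {s : Set ℝ}
    [CompactSpace s]
    (M : X → Matrix (Fin n) (Fin m) ℝ) (hM : Continuous M) (j : Fin m) (l : Fin n → C(X, s))
    (W : Submodule ℝ C(X, Fin n → ℝ)) (hW : IsClosed (W : Set C(X, Fin n → ℝ)))
    (h : ∀ (k : ℕ) (f : C(X, Fin n → ℝ)), (∀ x i, f x i = (l i x : ℝ) ^ k * M x i j) → f ∈ W)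
    (g : C(s, ℝ)) : colC M hM j l g ∈ W := by
  have hcl : IsClosed ((colC M hM j l) ⁻¹' (W : Set C(X, Fin n → ℝ))) :=
    hW.preimage (colC_cont M hM j l)
  have hsub : (polynomialFunctions s : Set C(s, ℝ)) ⊆
      (colC M hM j l) ⁻¹' (W : Set C(X, Fin n → ℝ)) := by
    rw [polynomialFunctions_coe]
    rintro _ ⟨p, rfl⟩
    change p.toContinuousMapOnAlgHom s ∈ W.comap (colC M hM j l)
    induction p using Polynomial.induction_on' with
    | add p q hp hq => rw [map_add]; exact add_mem hp hq
    | monomial k a =>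
      rw [← mul_one a, ← smul_eq_mul, ← Polynomial.smul_monomial, map_smul]
      apply Submodule.smul_mem
      apply h k
      intro x i
      simp [colC]
  have := hcl.closure_subset_iff.2 hsub
  apply this
  rw [← Subalgebra.topologicalClosure_coe, polynomialFunctions.topologicalClosure]
  trivial

lemma exists_local {K : Type*} [TopologicalSpace K] [CompactSpace K] [Nonempty K] {n m : ℕ}
    (lam : Fin n → C(K, ℝ)) (hlam : ∀ i, Function.Injective (lam i))
    (M : K → Matrix (Fin n) (Fin m) ℝ) (hM : Continuous M)
    (hc : ∀ βv : Fin n → K, IsControllablePair (Matrix.diagonal fun i => lam i (βv i))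
          (Matrix.of fun i j => M (βv i) i j))
    (F : C(K, Fin n → ℝ)) (ε : ℝ) (hε : 0 < ε) (z : ℝ) :
    ∃ u : Fin m → ℝ, ∀ᶠ y in nhds z, ∀ i β, lam i β = y → |F β i - (M β).mulVec u i| < ε := by
  classical
  let βv : Fin n → K := fun i => if h : ∃ β, lam i β = z then h.choose else Classical.arbitrary K
  have hβ : ∀ i β, lam i β = z → βv i = β := by
    intro i β hb
    have h : ∃ β, lam i β = z := ⟨β, hb⟩
    apply hlam i
    simp only [βv, dif_pos h]
    rw [h.choose_spec, hb]
  obtain ⟨u, hu⟩ : ∃ u : Fin m → ℝ, ∀ i, lam i (βv i) = z → (M (βv i)).mulVec u i = F (βv i) i := by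
    let V : Submodule ℝ (Fin n → ℝ) :=
      { carrier := {w | ∃ u : Fin m → ℝ, ∀ i, lam i (βv i) = z → (M (βv i)).mulVec u i = w i}
        zero_mem' := ⟨0, by simp⟩
        add_mem' := by
          rintro a b ⟨u, hu⟩ ⟨v, hv⟩
          exact ⟨u + v, fun i hi => by simp [Matrix.mulVec_add, hu i hi, hv i hi]⟩
        smul_mem' := by
          rintro c a ⟨u, hu⟩
          exact ⟨c • u, fun i hi => by simp [Matrix.mulVec_smul, hu i hi]⟩ }
    have hV : V = ⊤ := by
      rw [eq_top_iff, ← hc βv, Submodule.span_le]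
      rintro _ ⟨k, u, rfl⟩
      refine ⟨z ^ k • u, fun i hi => ?_⟩
      rw [Matrix.diagonal_pow, aux_diag, Matrix.mulVec_smul]
      simp only [Pi.smul_apply, Pi.pow_apply, hi, smul_eq_mul]
      rfl
    have : (fun i => F (βv i) i) ∈ V := hV ▸ trivial
    exact this
  refine ⟨u, Filter.eventually_all.2 fun i => ?_⟩
  have hcl : IsClosed {β | ε ≤ |F β i - (M β).mulVec u i|} := by
    refine isClosed_le continuous_const ?_
    have h1 : Continuous fun β => (M β).mulVec u i :=
      (continuous_apply i).comp (hM.matrix_mulVec continuous_const)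
    have h2 : Continuous fun β => F β i := (continuous_apply i).comp F.continuous
    exact (h2.sub h1).abs
  have hcl2 := (hcl.isCompact.image (lam i).continuous).isClosed
  have hz : z ∈ (lam i '' {β | ε ≤ |F β i - (M β).mulVec u i|})ᶜ := by
    rintro ⟨β, hb, hz⟩
    have e := hβ i β hz
    have := hu i (by rw [e, hz])
    rw [e] at this
    simp only [Set.mem_ofPred_eq, this, sub_self, abs_zero] at hb
    linarith
  filter_upwards [hcl2.isOpen_compl.mem_nhds hz] with y hy β hb
  by_contra hcon
  exact hy ⟨β, not_lt.1 hcon, hb⟩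

lemma exists_global {K : Type*} [TopologicalSpace K] [CompactSpace K] [Nonempty K] {n m : ℕ}
    (lam : Fin n → C(K, ℝ)) (hlam : ∀ i, Function.Injective (lam i))
    (M : K → Matrix (Fin n) (Fin m) ℝ) (hM : Continuous M)
    (hc : ∀ βv : Fin n → K, IsControllablePair (Matrix.diagonal fun i => lam i (βv i))
          (Matrix.of fun i j => M (βv i) i j))
    (F : C(K, Fin n → ℝ)) (ε : ℝ) (hε : 0 < ε) :
    ∃ g : C(ℝ, Fin m → ℝ), ∀ i β, |F β i - (M β).mulVec (g (lam i β)) i| < ε := by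
  obtain ⟨g, hg⟩ := exists_continuous_forall_mem_convex_of_local_const
    (t := fun y : ℝ => {u : Fin m → ℝ | ∀ i β, lam i β = y → |F β i - (M β).mulVec u i| < ε})
    (by
      intro y u hu v hv a b ha hb hab i β hy
      have h1 := hu i β hy
      have h2 := hv i β hy
      have h3 := convex_ball (F β i) ε (x := (M β).mulVec u i) (y := (M β).mulVec v i)
        (by rwa [Metric.mem_ball, dist_comm, Real.dist_eq])
        (by rwa [Metric.mem_ball, dist_comm, Real.dist_eq]) ha hb hab
      rw [Metric.mem_ball, dist_comm, Real.dist_eq] at h3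
      simpa [Matrix.mulVec_add, Matrix.mulVec_smul] using h3)
    (fun z => exists_local lam hlam M hM hc F ε hε z)
  exact ⟨g, fun i β => hg _ i β rfl⟩

lemma dense_core {K : Type*} [TopologicalSpace K] [CompactSpace K] [Nonempty K]
    [LocallyCompactSpace K] {n m : ℕ}
    (lam : Fin n → C(K, ℝ)) (hlam : ∀ i, Function.Injective (lam i))
    (M : K → Matrix (Fin n) (Fin m) ℝ) (hM : Continuous M)
    (hc : ∀ βv : Fin n → K, IsControllablePair (Matrix.diagonal fun i => lam i (βv i))
          (Matrix.of fun i j => M (βv i) i j))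
    (W : Submodule ℝ C(K, Fin n → ℝ)) (hW : IsClosed (W : Set C(K, Fin n → ℝ)))
    (h : ∀ (k : ℕ) (j : Fin m) (f : C(K, Fin n → ℝ)),
      (∀ x i, f x i = (lam i x : ℝ) ^ k * M x i j) → f ∈ W)
    (F : C(K, Fin n → ℝ)) : F ∈ W := by
  rw [← SetLike.mem_coe, ← hW.closure_eq, Metric.mem_closure_iff]
  intro ε hε
  obtain ⟨g, hg⟩ := exists_global lam hlam M hM hc F ε hε
  let s : Set ℝ := ⋃ i, Set.range (lam i)
  have hs : IsCompact s := isCompact_iUnion fun i => isCompact_range (lam i).continuous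
  have : CompactSpace s := isCompact_iff_compactSpace.1 hs
  let l : Fin n → C(K, s) := fun i => ⟨fun x => ⟨lam i x, Set.mem_iUnion.2 ⟨i, x, rfl⟩⟩,
    (lam i).continuous.subtype_mk _⟩
  let gj : Fin m → C(s, ℝ) := fun j => ⟨fun y => g y j,
    (continuous_apply j).comp (g.continuous.comp continuous_subtype_val)⟩
  refine ⟨∑ j, colC M hM j l (gj j), Submodule.sum_mem _ fun j _ =>
    colC_mem M hM j l W hW (fun k f hf => h k j f hf) _, ?_⟩
  rw [ContinuousMap.dist_lt_iff hε]
  intro x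
  rw [dist_pi_lt_iff hε]
  intro i
  rw [Real.dist_eq]
  convert hg i x using 3
  rw [ContinuousMap.sum_apply, Finset.sum_apply]
  simp only [Matrix.mulVec, dotProduct]
  exact Finset.sum_congr rfl fun j _ => mul_comm _ _

/-- An `n`-dimensional ensemble with `A(β) = P(β)Λ(β)P(β)⁻¹`, where the
eigenvalue functions `λ₁,…,λₙ` are continuous and injective, is uniformly ensemble
controllable on `C(K,ℝⁿ)` iff for every tuple `(β₁,…,βₙ) ∈ Kⁿ` the pair
`(diag(λ₁(β₁),…,λₙ(βₙ)), M)` is controllable on `ℝⁿ`, where the `i`-th row of `M` is the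
`i`-th row of `B̃(βᵢ) = P(βᵢ)⁻¹B(βᵢ)`. -/
theorem stmt4 (K : Set ℝ) (hK : IsCompact K) (hKne : K.Nonempty) (n m : ℕ)
    (A : K → Matrix (Fin n) (Fin n) ℝ) (B : K → Matrix (Fin n) (Fin m) ℝ)
    (hA : Continuous A) (hB : Continuous B)
    (P : K → Matrix (Fin n) (Fin n) ℝ) (hP : Continuous P)
    (hPinv : ∀ β : K, IsUnit (P β))
    (lam : Fin n → C(K, ℝ)) (hlam : ∀ i, Function.Injective (lam i))
    (hdiag : ∀ β : K,
      A β = P β * Matrix.diagonal (fun i => lam i β) * (P β)⁻¹) :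
    Dense (↑(Submodule.span ℝ
        {f : C(K, Fin n → ℝ) | ∃ (k : ℕ) (u : Fin m → ℝ), ∀ β : K,
          f β = ((A β) ^ k * B β).mulVec u}) : Set C(K, Fin n → ℝ)) ↔
      ∀ βv : Fin n → K,
        IsControllablePair (Matrix.diagonal fun i => lam i (βv i))
          (Matrix.of fun i j => ((P (βv i))⁻¹ * B (βv i)) i j) := by
  have : CompactSpace K := isCompact_iff_compactSpace.1 hK
  have : Nonempty K := hKne.to_subtype
  have hPi := aux_inv_cont P hP hPinv
  have hdet := fun β => (Matrix.isUnit_iff_isUnit_det _).1 (hPinv β)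
  have hpow := fun β k => aux_pow (A β) (P β) (B β) _ (hPinv β) (hdiag β) k
  constructor
  · intro hD βv
    let E : C(K, Fin n → ℝ) →ₗ[ℝ] (Fin n → ℝ) :=
      { toFun := fun f i => mulC _ hPi f (βv i) i
        map_add' := by intro f g; ext i; simp
        map_smul' := by intro f g; ext i; simp }
    have hE : Continuous E := by
      refine continuous_pi fun i => ?_
      have h0 : Continuous fun f => mulC _ hPi f (βv i) :=
        (continuous_eval_const (βv i)).comp (mulC_cont _ hPi)
      have h1 : Continuous fun f => mulC _ hPi f (βv i) i := (continuous_apply i).comp h0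
      exact h1
    have hs : Function.Surjective E := by
      intro v
      refine ⟨mulC P hP (ContinuousMap.const K v), ?_⟩
      ext i
      simp [E, mulC, Matrix.nonsing_inv_mul _ (hdet _)]
    have h1 := hs.denseRange.dense_image hE hD
    rw [← Submodule.map_coe, Submodule.map_span] at h1
    have h2 := (Submodule.closed_of_finiteDimensional _).closure_eq.symm.trans h1.closure_eq
    rw [IsControllablePair, eq_top_iff]
    rw [← Submodule.top_coe (R := ℝ), SetLike.coe_set_eq] at h2
    rw [← h2]
    apply Submodule.span_mono
    rintro _ ⟨f, ⟨k, u, hf⟩, rfl⟩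
    refine ⟨k, u, ?_⟩
    ext i
    rw [Matrix.diagonal_pow, aux_diag]
    change ((P (βv i))⁻¹.mulVec (f (βv i))) i = _
    rw [hf, Matrix.mulVec_mulVec, hpow, ← Matrix.mul_assoc, Matrix.nonsing_inv_mul _ (hdet _),
      Matrix.one_mul, aux_diag]
    rfl
  · intro hc
    rw [dense_iff_closure_eq, Set.eq_univ_iff_forall]
    intro f
    have hM : Continuous fun β => (P β)⁻¹ * B β := hPi.matrix_mul hB
    set S := Submodule.span ℝ
        {f : C(K, Fin n → ℝ) | ∃ (k : ℕ) (u : Fin m → ℝ), ∀ β : K,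
          f β = ((A β) ^ k * B β).mulVec u} with hS
    have key := dense_core lam hlam _ hM hc (S.topologicalClosure.comap (mulC P hP))
      (S.isClosed_topologicalClosure.preimage (mulC_cont P hP)) (by
        intro k j g hg
        rw [Submodule.mem_comap]
        apply S.le_topologicalClosure
        apply Submodule.subset_span
        refine ⟨k, Pi.single j 1, fun β => ?_⟩
        rw [hpow, ← Matrix.mulVec_mulVec]
        change (P β).mulVec (g β) = _
        congr 1
        ext i
        rw [hg, aux_diag]
        simp) (mulC _ hPi f)
    rw [Submodule.mem_comap] at key
    have e : mulC P hP (mulC _ hPi f) = f := by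
      ext β i
      simp [mulC, Matrix.mul_nonsing_inv _ (hdet _)]
    rw [e] at key
    exact key
end

section
/- Let K ⊂ ℝ be a nonempty compact set. Let A : K → ℝ^{n×n} and B : K → ℝ^{n×m} be continuous, and suppose there are a continuous map P : K → GL(n,ℝ) and continuous functions λ₁, …, λₙ ∈ C(K,ℝ) (not necessarily injective) such that A(β) = P(β) Λ(β) P(β)⁻¹ for all β ∈ K, where Λ(β) = diag(λ₁(β), …, λₙ(β)). Let B̃(β) = P(β)⁻¹ B(β) with rows b̃₁(β), …, b̃ₙ(β) ∈ ℝ^{1×m}. Then the linear span of the functions β ↦ A(β)^k B(β)u, over k ∈ ℕ and u ∈ ℝ^m, is dense in C(K,ℝⁿ) with respect to the supremum norm if and only if for every n-tuple (η₁, …, ηₙ) ∈ λ₁(K) × ⋯ × λₙ(K): each fiber λᵢ⁻¹(ηᵢ) = {β ∈ K : λᵢ(β) = ηᵢ} is finite, and, letting S = {(i,β) : 1 ≤ i ≤ n, β ∈ λᵢ⁻¹(ηᵢ)} and N = |S|, the matrix pair (A_S, B_S) is controllable on ℝ^S ≅ ℝ^N, where A_S is the diagonal matrix indexed by S with diagonal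 entry ηᵢ at index (i,β), and B_S is the matrix indexed by S × {1,…,m} whose row at index (i,β) is b̃ᵢ(β). -/
/-- A matrix pair `(A, B)` with state space indexed by a finite type `S` is controllable on
`ℝ^S ≅ ℝ^N` (Kalman rank condition): `span{A^k B u : k ∈ ℕ, u ∈ ℝ^m} = ℝ^S`. -/
def IsControllablePairOn (S : Type*) [Fintype S] [DecidableEq S] {m : ℕ}
    (A : Matrix S S ℝ) (B : Matrix S (Fin m) ℝ) : Prop :=
  Submodule.span ℝ
    {v : S → ℝ | ∃ (k : ℕ) (u : Fin m → ℝ), v = (A ^ k * B).mulVec u} = ⊤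

open Matrix in
/-- The span of the moment functions in scalar form. -/
def momentSpan {X : Type*} [TopologicalSpace X] {m : ℕ} (L : C(X, ℝ)) (b : X → Fin m → ℝ) :
    Submodule ℝ C(X, ℝ) :=
  Submodule.span ℝ {f | ∃ (k : ℕ) (u : Fin m → ℝ), ∀ x, f x = L x ^ k * (b x ⬝ᵥ u)}

theorem momentSpan_mul {X : Type*} [TopologicalSpace X] {m : ℕ} (L : C(X, ℝ))
    (b : X → Fin m → ℝ) (g : C(X, ℝ)) (hg : g ∈ momentSpan L b) : L * g ∈ momentSpan L b := by
  induction hg using Submodule.span_induction with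
  | mem f hf =>
    obtain ⟨k, u, h⟩ := hf
    refine Submodule.subset_span ⟨k + 1, u, fun x => ?_⟩
    simp [h, pow_succ]; ring
  | zero => simp
  | add f g _ _ hf hg => rw [mul_add]; exact Submodule.add_mem _ hf hg
  | smul c f _ hf => rw [mul_smul_comm]; exact Submodule.smul_mem _ _ hf

theorem momentSpan_poly {X : Type*} [TopologicalSpace X] {m : ℕ} (L : C(X, ℝ))
    (b : X → Fin m → ℝ) (g : C(X, ℝ)) (hg : g ∈ momentSpan L b) (p : Polynomial ℝ) :
    Polynomial.aeval L p * g ∈ momentSpan L b := by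
  induction p using Polynomial.induction_on' with
  | add p q hp hq => rw [map_add, add_mul]; exact Submodule.add_mem _ hp hq
  | monomial k a =>
    rw [Polynomial.aeval_monomial, ← Algebra.smul_def, smul_mul_assoc]
    refine Submodule.smul_mem _ _ ?_
    induction k with
    | zero => simpa using hg
    | succ k ih => rw [pow_succ', mul_assoc]; exact momentSpan_mul L b _ ih

theorem aeval_cm_apply {X : Type*} [TopologicalSpace X] (L : C(X, ℝ)) (p : Polynomial ℝ) (x : X) :
    (Polynomial.aeval L p) x = p.eval (L x) := by
  induction p using Polynomial.induction_on' with
  | add p q hp hq => simp [hp, hq]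
  | monomial k a => simp [Polynomial.aeval_monomial, algebraMap_apply]

theorem momentSpan_comp {X : Type*} [TopologicalSpace X] [CompactSpace X] {m : ℕ} (L : C(X, ℝ))
    (b : X → Fin m → ℝ) (g : C(X, ℝ)) (hg : g ∈ momentSpan L b) (q : C(ℝ, ℝ)) :
    q.comp L * g ∈ (momentSpan L b).topologicalClosure := by
  change _ ∈ closure ((momentSpan L b : Set C(X, ℝ)))
  rw [Metric.mem_closure_iff]
  intro ε hε
  have hg0 : 0 < ‖g‖ + 1 := by positivity
  obtain ⟨p, hp⟩ := exists_polynomial_near_of_continuousOn (-‖L‖) ‖L‖ q q.continuous.continuousOn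
    (ε / (‖g‖ + 1)) (by positivity)
  refine ⟨_, momentSpan_poly L b g hg p, ?_⟩
  rw [ContinuousMap.dist_lt_iff hε]
  intro x
  have h1 := hp (L x) (abs_le.mp (L.norm_coe_le_norm x))
  have h2 : |g x| ≤ ‖g‖ := g.norm_coe_le_norm x
  rw [Real.dist_eq, abs_sub_comm]
  simp only [ContinuousMap.mul_apply, aeval_cm_apply, ContinuousMap.comp_apply]
  rw [← sub_mul, abs_mul]
  calc _ ≤ |Polynomial.eval (L x) p - q (L x)| * ‖g‖ := by gcongr
    _ ≤ ε / (‖g‖ + 1) * ‖g‖ := by gcongr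
    _ < ε / (‖g‖ + 1) * (‖g‖ + 1) := by gcongr; linarith
    _ = ε := by field_simp

theorem momentSpan_dense {X : Type*} [TopologicalSpace X] [CompactSpace X] {m : ℕ} (L : C(X, ℝ))
    (b : X → Fin m → ℝ)
    (H : ∀ (f : C(X, ℝ)) (z : ℝ), ∃ g ∈ momentSpan L b, ∀ x, L x = z → g x = f x) :
    Dense (momentSpan L b : Set C(X, ℝ)) := by
  intro f
  rw [← closure_closure]
  rw [Metric.mem_closure_iff]
  intro ε' hε'
  obtain ⟨ε, hε, hεε'⟩ := exists_between hε'
  choose g hg hgf using H f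
  let Cs : ℝ → Set X := fun z => {x | ε ≤ |g z x - f x|}
  have hC : ∀ z, IsClosed (Cs z) := fun z =>
    isClosed_le continuous_const (((g z).continuous.sub f.continuous).abs)
  let U : ℝ → Set ℝ := fun z => (L '' Cs z)ᶜ
  have hU : ∀ z, IsOpen (U z) := fun z =>
    ((hC z).isCompact.image L.continuous).isClosed.isOpen_compl
  have hzU : ∀ z, z ∈ U z := by
    rintro z ⟨x, hx, hxz⟩
    have : ε ≤ |g z x - f x| := hx
    rw [hgf z x hxz] at this
    simp at this; linarith
  have hcomp : IsCompact (Set.range L) := isCompact_range L.continuous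
  obtain ⟨t, ht⟩ := hcomp.elim_finite_subcover U hU (fun z _ => Set.mem_iUnion.2 ⟨z, hzU z⟩)
  obtain ⟨ρ, hρ⟩ := PartitionOfUnity.exists_isSubordinate hcomp.isClosed (fun i : t => U i)
    (fun i => hU i) (fun z hz => by
      obtain ⟨i, hi, hz⟩ := Set.mem_iUnion₂.1 (ht hz)
      exact Set.mem_iUnion.2 ⟨⟨i, hi⟩, hz⟩)
  refine ⟨∑ i : t, (ρ i).comp L * g i, ?_, ?_⟩
  · exact Submodule.sum_mem (momentSpan L b).topologicalClosure
      fun i _ => momentSpan_comp L b _ (hg i) _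
  · refine lt_of_le_of_lt ?_ hεε'
    rw [ContinuousMap.dist_le hε.le]
    intro x
    have h1 : ∑ i : t, ρ i (L x) = 1 := by
      rw [← finsum_eq_sum_of_fintype]; exact ρ.sum_eq_one ⟨x, rfl⟩
    rw [dist_comm, Real.dist_eq]
    have h2 : (∑ i : t, (ρ i).comp L * g i) x - f x = ∑ i : t, ρ i (L x) * (g i x - f x) := by
      simp only [mul_sub, Finset.sum_sub_distrib, ← Finset.sum_mul, h1, one_mul]
      simp [ContinuousMap.sum_apply]
    rw [h2]
    calc _ ≤ ∑ i : t, |ρ i (L x) * (g i x - f x)| := Finset.abs_sum_le_sum_abs _ _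
      _ ≤ ∑ i : t, ρ i (L x) * ε := by
        refine Finset.sum_le_sum fun i _ => ?_
        rw [abs_mul, abs_of_nonneg (ρ.nonneg i _)]
        by_cases h0 : ρ i (L x) = 0
        · simp [h0]
        · have : L x ∈ U i := hρ i (subset_tsupport _ h0)
          refine mul_le_mul_of_nonneg_left ?_ (ρ.nonneg i _)
          by_contra hlt
          exact this ⟨x, (not_le.1 hlt).le, rfl⟩
      _ = ε := by rw [← Finset.sum_mul, h1, one_mul]

theorem diag_gen {n m : ℕ} (A P : Matrix (Fin n) (Fin n) ℝ) (B : Matrix (Fin n) (Fin m) ℝ)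
    (hP : IsUnit P) (d : Fin n → ℝ) (h : A = P * Matrix.diagonal d * P⁻¹) (k : ℕ)
    (u : Fin m → ℝ) :
    (A ^ k * B).mulVec u = P.mulVec fun i => d i ^ k * dotProduct ((P⁻¹ * B) i) u := by
  have hdet : IsUnit P.det := (Matrix.isUnit_iff_isUnit_det P).1 hP
  have hk : A ^ k = P * Matrix.diagonal (d ^ k) * P⁻¹ := by
    induction k with
    | zero => simp [Matrix.mul_nonsing_inv P hdet]
    | succ k ih =>
      rw [pow_succ, ih, h]
      have : Matrix.diagonal (d ^ (k+1)) = Matrix.diagonal (d ^ k) * Matrix.diagonal d := by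
        rw [Matrix.diagonal_mul_diagonal]; rfl
      rw [this]
      simp only [Matrix.mul_assoc]
      rw [← Matrix.mul_assoc P⁻¹ P, Matrix.nonsing_inv_mul P hdet, Matrix.one_mul]
  rw [hk, Matrix.mul_assoc, Matrix.mul_assoc, ← Matrix.mulVec_mulVec, ← Matrix.mulVec_mulVec]
  congr 1
  ext i
  rw [Matrix.mulVec_diagonal]
  rfl

theorem pair_gen {S : Type*} {_ : Fintype S} {_ : DecidableEq S} {m : ℕ} (d : S → ℝ)
    (B : Matrix S (Fin m) ℝ) (k : ℕ) (u : Fin m → ℝ) :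
    (Matrix.diagonal d ^ k * B).mulVec u = fun s => d s ^ k * dotProduct (B s) u := by
  rw [Matrix.diagonal_pow, ← Matrix.mulVec_mulVec]
  ext i
  rw [Matrix.mulVec_diagonal]
  rfl

/-- evaluation at a finite family of points after the change of coordinates -/
theorem restrict_top {K : Set ℝ} {n m : ℕ}
    (A : K → Matrix (Fin n) (Fin n) ℝ) (B : K → Matrix (Fin n) (Fin m) ℝ)
    (P : K → Matrix (Fin n) (Fin n) ℝ) (hP : Continuous P)
    (hPinv : ∀ β : K, IsUnit (P β))
    (lam : Fin n → C(K, ℝ))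
    (hdiag : ∀ β : K,
      A β = P β * Matrix.diagonal (fun i => lam i β) * (P β)⁻¹)
    (hd : Dense (↑(Submodule.span ℝ
        {f : C(K, Fin n → ℝ) | ∃ (k : ℕ) (u : Fin m → ℝ), ∀ β : K,
          f β = ((A β) ^ k * B β).mulVec u}) : Set C(K, Fin n → ℝ)))
    {S : Type*} [Fintype S] (σ : S → Fin n × K) (hσ : Function.Injective σ) :
    Submodule.span ℝ {v : S → ℝ | ∃ (k : ℕ) (u : Fin m → ℝ), v = fun s =>
      lam (σ s).1 (σ s).2 ^ k * dotProduct (((P (σ s).2)⁻¹ * B (σ s).2) (σ s).1) u} = ⊤ := by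
  classical
  have hdet : ∀ β, IsUnit (P β).det := fun β => (Matrix.isUnit_iff_isUnit_det _).1 (hPinv β)
  have hinv : ∀ β (v : Fin n → ℝ), (P β)⁻¹.mulVec ((P β).mulVec v) = v := fun β v => by
    rw [Matrix.mulVec_mulVec, Matrix.nonsing_inv_mul _ (hdet β), Matrix.one_mulVec]
  let R : C(K, Fin n → ℝ) →ₗ[ℝ] (S → ℝ) :=
    { toFun := fun f s => ((P (σ s).2)⁻¹.mulVec (f (σ s).2)) (σ s).1
      map_add' := fun f g => by ext s; simp [Matrix.mulVec_add]
      map_smul' := fun c f => by ext s; simp [Matrix.mulVec_smul] }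
  have hRc : Continuous R := by
    refine continuous_pi fun s => ?_
    have : Continuous fun f : C(K, Fin n → ℝ) => (P (σ s).2)⁻¹.mulVec (f (σ s).2) :=
      Continuous.matrix_mulVec continuous_const (ContinuousEvalConst.continuous_eval_const _)
    exact (continuous_apply (σ s).1).comp this
  have hRs : Function.Surjective R := by
    intro w
    let r : Fin n × K → ℝ := Function.extend σ w 0
    let t : Finset K := Finset.univ.image fun s => (σ s).2
    let q : Fin n → Polynomial ℝ := fun i =>
      Lagrange.interpolate t (fun β : K => (β : ℝ)) (fun β => r (i, β))
    refine ⟨⟨fun β => (P β).mulVec fun i => (q i).eval (β : ℝ), ?_⟩, ?_⟩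
    · refine Continuous.matrix_mulVec hP (continuous_pi fun i => ?_)
      exact (q i).continuous.comp continuous_subtype_val
    · ext s
      change ((P (σ s).2)⁻¹.mulVec ((P (σ s).2).mulVec fun i => (q i).eval ((σ s).2 : ℝ))) (σ s).1
        = w s
      rw [hinv]
      have := Lagrange.eval_interpolate_at_node (s := t) (v := fun β : K => (β : ℝ))
        (fun β => r ((σ s).1, β)) (Subtype.val_injective.injOn) (i := (σ s).2)
        (Finset.mem_image.2 ⟨s, Finset.mem_univ _, rfl⟩)
      refine this.trans ?_
      exact hσ.extend_apply w 0 s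
  have hdense := hRs.denseRange.dense_image hRc hd
  rw [← Submodule.map_coe] at hdense
  have hcl : ∀ V : Submodule ℝ (S → ℝ), Dense (V : Set (S → ℝ)) → V = ⊤ := fun V hV => by
    rw [← SetLike.coe_set_eq, ← (Submodule.closed_of_finiteDimensional V).closure_eq,
      hV.closure_eq]; rfl
  have hmap : Submodule.map R (Submodule.span ℝ
        {f : C(K, Fin n → ℝ) | ∃ (k : ℕ) (u : Fin m → ℝ), ∀ β : K,
          f β = ((A β) ^ k * B β).mulVec u}) = ⊤ := hcl _ hdense
  rw [eq_top_iff, ← hmap, Submodule.map_span, Submodule.span_le]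
  rintro _ ⟨f, ⟨k, u, hf⟩, rfl⟩
  refine Submodule.subset_span ⟨k, u, ?_⟩
  ext s
  change ((P (σ s).2)⁻¹.mulVec (f (σ s).2)) (σ s).1 = _
  rw [hf, diag_gen _ _ _ (hPinv _) _ (hdiag _), hinv]

/-- An `n`-dimensional ensemble with `A(β) = P(β)Λ(β)P(β)⁻¹`, where the
eigenvalue functions `λ₁,…,λₙ` are continuous (not necessarily injective), is uniformly
ensemble controllable on `C(K,ℝⁿ)` iff for every tuple `(η₁,…,ηₙ) ∈ λ₁(K) × ⋯ × λₙ(K)`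
each fiber `λᵢ⁻¹(ηᵢ)` is finite and, with `S = {(i,β) : β ∈ λᵢ⁻¹(ηᵢ)}`, the pair
`(A_S, B_S)` is controllable on `ℝ^S`, where `A_S = diag(ηᵢ at (i,β))` and the row of
`B_S` at `(i,β)` is the `i`-th row of `B̃(β) = P(β)⁻¹B(β)`. -/
theorem stmt5 (K : Set ℝ) (hK : IsCompact K) (hKne : K.Nonempty) (n m : ℕ)
    (A : K → Matrix (Fin n) (Fin n) ℝ) (B : K → Matrix (Fin n) (Fin m) ℝ)
    (hA : Continuous A) (hB : Continuous B)
    (P : K → Matrix (Fin n) (Fin n) ℝ) (hP : Continuous P)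
    (hPinv : ∀ β : K, IsUnit (P β))
    (lam : Fin n → C(K, ℝ))
    (hdiag : ∀ β : K,
      A β = P β * Matrix.diagonal (fun i => lam i β) * (P β)⁻¹) :
    Dense (↑(Submodule.span ℝ
        {f : C(K, Fin n → ℝ) | ∃ (k : ℕ) (u : Fin m → ℝ), ∀ β : K,
          f β = ((A β) ^ k * B β).mulVec u}) : Set C(K, Fin n → ℝ)) ↔
      ∀ η : Fin n → ℝ, (∀ i, η i ∈ Set.range (lam i)) →
        ∃ hfin : ∀ i, {β : K | lam i β = η i}.Finite,
          letI : ∀ i : Fin n, Fintype {β : K | lam i β = η i} :=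
            fun i => (hfin i).fintype
          letI : DecidableEq ((i : Fin n) × {β : K | lam i β = η i}) :=
            Classical.decEq _
          IsControllablePairOn ((i : Fin n) × {β : K | lam i β = η i})
            (Matrix.diagonal fun p => η p.1)
            (Matrix.of fun p j => ((P p.2.1)⁻¹ * B p.2.1) p.1 j) := by
  classical
  haveI : CompactSpace K := isCompact_iff_compactSpace.1 hK
  have hdet : ∀ β, IsUnit (P β).det := fun β => (Matrix.isUnit_iff_isUnit_det _).1 (hPinv β)
  constructor
  · intro hd η hη
    have hfin : ∀ i, {β : K | lam i β = η i}.Finite := by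
      intro i
      by_contra hinf
      obtain ⟨t, hts, htc⟩ := Set.Infinite.exists_subset_card_eq hinf (m + 1)
      have htop := restrict_top A B P hP hPinv lam hdiag hd (S := t) (fun s => (i, s.1))
        (fun s s' h => Subtype.ext (Prod.ext_iff.1 h).2)
      let Φ : (Fin m → ℝ) →ₗ[ℝ] (t → ℝ) :=
        (Matrix.of fun (s : t) j => ((P s.1)⁻¹ * B s.1) i j).mulVecLin
      have hle : (⊤ : Submodule ℝ (t → ℝ)) ≤ LinearMap.range Φ := by
        rw [← htop, Submodule.span_le]
        rintro _ ⟨k, u, rfl⟩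
        refine ⟨η i ^ k • u, ?_⟩
        ext s
        have hs : lam i s.1 = η i := hts s.2
        rw [map_smul]
        simp only [hs]
        rfl
      have hsurj : Function.Surjective Φ := LinearMap.range_eq_top.1 (top_le_iff.1 hle)
      have := LinearMap.finrank_le_finrank_of_surjective hsurj
      simp [htc] at this
    refine ⟨hfin, ?_⟩
    letI : ∀ i : Fin n, Fintype {β : K | lam i β = η i} := fun i => (hfin i).fintype
    have htop := restrict_top A B P hP hPinv lam hdiag hd
      (S := (i : Fin n) × {β : K | lam i β = η i}) (fun s => (s.1, s.2.1))
      (by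
        rintro ⟨i, β, h⟩ ⟨j, γ, h'⟩ heq
        obtain ⟨h1, h2⟩ := Prod.ext_iff.1 heq
        simp only at h1 h2
        subst h1 h2
        rfl)
    unfold IsControllablePairOn
    rw [eq_top_iff, ← htop, Submodule.span_le]
    rintro _ ⟨k, u, rfl⟩
    refine Submodule.subset_span ⟨k, u, ?_⟩
    rw [pair_gen]
    ext s
    have hs : lam s.1 s.2.1 = η s.1 := s.2.2
    simp only [hs]
    rfl
  · intro H
    have hPic : Continuous fun β => (P β)⁻¹ := by
      have : (fun β => (P β)⁻¹) = fun β => ((P β).det)⁻¹ • (P β).adjugate := by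
        ext1 β
        rw [Matrix.inv_def, Ring.inverse_eq_inv']
      rw [this]
      exact (hP.matrix_det.inv₀ fun β => (hdet β).ne_zero).smul hP.matrix_adjugate
    have hbc : Continuous fun β => (P β)⁻¹ * B β := hPic.matrix_mul hB
    let L : C(Fin n × K, ℝ) :=
      ⟨fun x => lam x.1 x.2, continuous_prod_of_discrete_left.2 fun i => (lam i).continuous⟩
    let b : Fin n × K → Fin m → ℝ := fun x => ((P x.2)⁻¹ * B x.2) x.1
    have hb : Continuous b := continuous_prod_of_discrete_left.2 fun i =>
      (continuous_apply i).comp hbc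
    have hdense : Dense (momentSpan L b : Set C(Fin n × K, ℝ)) := by
      apply momentSpan_dense
      intro f z
      obtain ⟨β0, hβ0⟩ := hKne
      let η : Fin n → ℝ := fun i => if z ∈ Set.range (lam i) then z else lam i ⟨β0, hβ0⟩
      have hη : ∀ i, η i ∈ Set.range (lam i) := by
        intro i
        by_cases h : z ∈ Set.range (lam i)
        · simp only [η, if_pos h]; exact h
        · simp only [η, if_neg h]; exact ⟨_, rfl⟩
      obtain ⟨hfin, hc⟩ := H η hη
      letI : ∀ i : Fin n, Fintype {β : K | lam i β = η i} := fun i => (hfin i).fintype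
      unfold IsControllablePairOn at hc
      let R : C(Fin n × K, ℝ) →ₗ[ℝ] (((i : Fin n) × {β : K | lam i β = η i}) → ℝ) :=
        { toFun := fun g s => g (s.1, s.2.1)
          map_add' := fun _ _ => rfl
          map_smul' := fun _ _ => rfl }
      have hle : (⊤ : Submodule ℝ (((i : Fin n) × {β : K | lam i β = η i}) → ℝ)) ≤
          Submodule.map R (momentSpan L b) := by
        rw [← hc, Submodule.span_le]
        rintro _ ⟨k, u, rfl⟩
        refine ⟨⟨fun x => L x ^ k * dotProduct (b x) u, ?_⟩,
          Submodule.subset_span ⟨k, u, fun x => rfl⟩, ?_⟩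
        · exact (L.continuous.pow k).mul (hb.dotProduct continuous_const)
        · rw [pair_gen]
          ext s
          have hs : lam s.1 s.2.1 = η s.1 := s.2.2
          rw [← hs]
          rfl
      obtain ⟨g, hg, hgR⟩ := hle (Submodule.mem_top (x := R f))
      refine ⟨g, hg, ?_⟩
      rintro ⟨i, β⟩ hx
      have hx' : lam i β = z := hx
      have hzη : η i = z := if_pos ⟨β, hx'⟩
      exact congrFun hgR ⟨i, β, hx'.trans hzη.symm⟩
    let T : C(Fin n × K, ℝ) →ₗ[ℝ] C(K, Fin n → ℝ) :=
      { toFun := fun h => ⟨fun β => (P β).mulVec fun i => h (i, β),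
          Continuous.matrix_mulVec hP (by fun_prop)⟩
        map_add' := fun f g => by
          ext1 β
          exact Matrix.mulVec_add (P β) (fun i => f (i, β)) (fun i => g (i, β))
        map_smul' := fun c f => by
          ext1 β
          exact Matrix.mulVec_smul (P β) c (fun i => f (i, β)) }
    have hTc : Continuous T := by
      apply ContinuousMap.continuous_of_continuous_uncurry
      change Continuous fun x : C(Fin n × K, ℝ) × K => (P x.2).mulVec fun i => x.1 (i, x.2)
      exact Continuous.matrix_mulVec (hP.comp continuous_snd) (by fun_prop)
    have hTs : Function.Surjective T := by
      intro f
      have hc : Continuous fun β => (P β)⁻¹.mulVec (f β) :=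
        Continuous.matrix_mulVec hPic f.continuous
      refine ⟨⟨fun x => ((P x.2)⁻¹.mulVec (f x.2)) x.1,
        continuous_prod_of_discrete_left.2 fun i => (continuous_apply i).comp hc⟩, ?_⟩
      ext1 β
      change (P β).mulVec ((P β)⁻¹.mulVec (f β)) = f β
      rw [Matrix.mulVec_mulVec, Matrix.mul_nonsing_inv _ (hdet β), Matrix.one_mulVec]
    refine (hTs.denseRange.dense_image hTc hdense).mono ?_
    rw [← Submodule.map_coe, SetLike.coe_subset_coe, momentSpan, Submodule.map_span,
      Submodule.span_le]
    rintro _ ⟨f, ⟨k, u, hf⟩, rfl⟩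
    refine Submodule.subset_span ⟨k, u, fun β => ?_⟩
    rw [diag_gen _ _ _ (hPinv _) _ (hdiag _)]
    change (P β).mulVec (fun i => f (i, β)) = _
    simp only [hf]
    rfl
end

section
/- Let K ⊂ ℝ be a nonempty compact set and let A : K → ℝ^{n×n} and B : K → ℝ^{n×m} be continuous. If the linear span of the functions β ↦ A(β)^k B(β)u, over k ∈ ℕ and u ∈ ℝ^m, is dense in C(K,ℝⁿ) with respect to the supremum norm, then for every fixed β ∈ K the matrix pair (A(β), B(β)) is controllable on ℝⁿ, i.e., span{A(β)^k B(β)u : k ∈ ℕ, u ∈ ℝ^m} = ℝⁿ. -/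
/-- If the ensemble `(A, B)` is uniformly ensemble controllable on `C(K,ℝⁿ)`
(i.e. the span of `{β ↦ A(β)^k B(β)u}` is dense in `C(K,ℝⁿ)`), then for every fixed `β ∈ K`
the pair `(A(β), B(β))` is controllable on `ℝⁿ`:
`span{A(β)^k B(β)u : k ∈ ℕ, u ∈ ℝ^m} = ℝⁿ`. -/
theorem stmt10 (K : Set ℝ) (hK : IsCompact K) (hKne : K.Nonempty) (n m : ℕ)
    (A : K → Matrix (Fin n) (Fin n) ℝ) (B : K → Matrix (Fin n) (Fin m) ℝ)
    (hA : Continuous A) (hB : Continuous B)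
    (hdense : Dense (↑(Submodule.span ℝ
        {f : C(K, Fin n → ℝ) | ∃ (k : ℕ) (u : Fin m → ℝ), ∀ β : K,
          f β = ((A β) ^ k * B β).mulVec u}) : Set C(K, Fin n → ℝ))) :
    ∀ β : K,
      Submodule.span ℝ
        {v : Fin n → ℝ | ∃ (k : ℕ) (u : Fin m → ℝ),
          v = ((A β) ^ k * B β).mulVec u} = ⊤ := by
  intro β
  set S := Submodule.span ℝ
        {v : Fin n → ℝ | ∃ (k : ℕ) (u : Fin m → ℝ),
          v = ((A β) ^ k * B β).mulVec u} with hS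
  have hev : Continuous (fun f : C(K, Fin n → ℝ) => f β) :=
    continuous_eval_const β
  let ev : C(K, Fin n → ℝ) →ₗ[ℝ] (Fin n → ℝ) :=
    { toFun := fun f => f β
      map_add' := fun _ _ => rfl
      map_smul' := fun _ _ => rfl }
  have hle : Submodule.span ℝ
        {f : C(K, Fin n → ℝ) | ∃ (k : ℕ) (u : Fin m → ℝ), ∀ β : K,
          f β = ((A β) ^ k * B β).mulVec u} ≤ S.comap ev := by
    refine Submodule.span_le.2 ?_
    rintro f ⟨k, u, hf⟩
    exact Submodule.subset_span ⟨k, u, hf β⟩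
  have hclosed : IsClosed ((S.comap ev : Submodule ℝ C(K, Fin n → ℝ)) : Set C(K, Fin n → ℝ)) :=
    (Submodule.closed_of_finiteDimensional S).preimage hev
  refine (Submodule.eq_top_iff'.2 fun v => ?_)
  have h := closure_minimal hle hclosed (hdense (ContinuousMap.const K v))
  exact h
end

section
/- The linear span of the functions {β ↦ cos(β)^k : k ∈ ℕ} ∪ {β ↦ β·cos(β)^k : k ∈ ℕ} is dense in C([-π,π],ℝ) with respect to the supremum norm. (Equivalently, the scalar two-input ensemble dx/dt(t,β) = cos(β)x(t,β) + u₁(t) + βu₂(t), β ∈ [-π,π], is uniformly ensemble controllable on C([-π,π],ℝ).) -/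
theorem aux_top (a b : ℝ) (N : Submodule ℝ C(Set.Icc a b, ℝ))
    (hN : IsClosed (N : Set C(Set.Icc a b, ℝ)))
    (h : ∀ (k : ℕ) (f : C(Set.Icc a b, ℝ)), (∀ x, f x = (x : ℝ) ^ k) → f ∈ N)
    (f : C(Set.Icc a b, ℝ)) : f ∈ N := by
  have h1 : (polynomialFunctions (Set.Icc a b) : Set C(Set.Icc a b, ℝ)) ⊆ N := by
    intro g hg
    rw [polynomialFunctions_coe] at hg
    obtain ⟨p, rfl⟩ := hg
    induction p using Polynomial.induction_on' with
    | add p q hp hq => rw [map_add]; exact N.add_mem hp hq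
    | monomial n c =>
      rw [← mul_one c, ← smul_eq_mul, ← Polynomial.smul_monomial, map_smul]
      refine N.smul_mem _ (h n _ fun x => ?_)
      simp
  have h2 : f ∈ (polynomialFunctions (Set.Icc a b)).topologicalClosure := by
    rw [polynomialFunctions_closure_eq_top]; trivial
  exact closure_minimal h1 hN h2

theorem aux_mul (M : Submodule ℝ C(Set.Icc (-Real.pi) Real.pi, ℝ))
    (hM : IsClosed (M : Set C(Set.Icc (-Real.pi) Real.pi, ℝ)))
    (w : C(Set.Icc (-Real.pi) Real.pi, ℝ))
    (h : ∀ (k : ℕ) (f : C(Set.Icc (-Real.pi) Real.pi, ℝ)),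
      (∀ x, f x = w x * Real.cos x ^ k) → f ∈ M)
    (n : ℕ) (f : C(Set.Icc (-Real.pi) Real.pi, ℝ))
    (hf : ∀ x, f x = w x * |(x : ℝ)| ^ n) : f ∈ M := by
  let c : C(Set.Icc (-Real.pi) Real.pi, Set.Icc (-1 : ℝ) 1) :=
    ⟨fun x => ⟨Real.cos x, Real.cos_mem_Icc _⟩, by fun_prop⟩
  let T : C(Set.Icc (-1 : ℝ) 1, ℝ) →ₗ[ℝ] C(Set.Icc (-Real.pi) Real.pi, ℝ) :=
    { toFun := fun g => w * g.comp c
      map_add' := fun g k => by ext x; simp [mul_add]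
      map_smul' := fun r g => by ext x; simp }
  have hT : Continuous T := by
    change Continuous fun g : C(Set.Icc (-1 : ℝ) 1, ℝ) => w * g.comp c
    exact continuous_const.mul (ContinuousMap.continuous_precomp c)
  let g : C(Set.Icc (-1 : ℝ) 1, ℝ) :=
    ⟨fun y => Real.arccos y ^ n, (Real.continuous_arccos.comp continuous_subtype_val).pow n⟩
  have hg : g ∈ M.comap T := by
    refine aux_top _ _ _ (hM.preimage hT) (fun k q hq => ?_) g
    refine h k _ fun x => ?_
    change w x * q (c x) = _
    rw [hq]; rfl
  have : f = T g := by
    ext x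
    rw [hf]
    change _ = w x * Real.arccos (Real.cos x) ^ n
    rw [← Real.cos_abs, Real.arccos_cos (abs_nonneg _) (abs_le.2 x.2)]
  rw [this]; exact hg


open Real in
/-- The span of `{β ↦ cos(β)^k} ∪ {β ↦ β·cos(β)^k}` over `k ∈ ℕ` is dense in
`C([-π,π],ℝ)` w.r.t. the sup norm, i.e. the scalar two-input ensemble
`ẋ(t,β) = cos(β)x(t,β) + u₁(t) + βu₂(t)` is uniformly ensemble controllable. -/
theorem stmt13 :
    Dense (↑(Submodule.span ℝ
        {f : C(Set.Icc (-π) π, ℝ) | ∃ k : ℕ,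
          (∀ β : Set.Icc (-π) π, f β = Real.cos β ^ k) ∨
          (∀ β : Set.Icc (-π) π, f β = (β : ℝ) * Real.cos β ^ k)}) :
      Set C(Set.Icc (-π) π, ℝ)) := by
  rw [Submodule.dense_iff_topologicalClosure_eq_top, Submodule.eq_top_iff']
  set S := {f : C(Set.Icc (-π) π, ℝ) | ∃ k : ℕ,
          (∀ β : Set.Icc (-π) π, f β = Real.cos β ^ k) ∨
          (∀ β : Set.Icc (-π) π, f β = (β : ℝ) * Real.cos β ^ k)} with hS
  have hS' : ∀ f ∈ S, f ∈ (Submodule.span ℝ S).topologicalClosure := fun f hf =>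
    Submodule.le_topologicalClosure _ (Submodule.subset_span hf)
  have hM := (Submodule.span ℝ S).isClosed_topologicalClosure
  refine aux_top _ _ _ hM fun k f hf => ?_
  obtain ⟨n, rfl | rfl⟩ := Nat.even_or_odd' k
  · refine aux_mul _ hM 1 (fun k q hq => hS' q ⟨k, Or.inl fun x => ?_⟩) (2 * n) f fun x => ?_
    · rw [hq]; simp
    · rw [hf, pow_mul, pow_mul, sq_abs]; simp
  · refine aux_mul _ hM ⟨fun x => (x : ℝ), continuous_subtype_val⟩
      (fun k q hq => hS' q ⟨k, Or.inr fun x => ?_⟩) (2 * n) f fun x => ?_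
    · rw [hq]; rfl
    · rw [hf, pow_succ', pow_mul, pow_mul, sq_abs]; rfl
end

section
/- Let K ⊂ ℝ be an infinite compact set, let A = diag(ρ₁, …, ρₙ) ∈ ℝ^{n×n} be a constant diagonal matrix, and let B ∈ ℝ^{n×m} be a constant matrix. If ρᵢ = 0 for some index i ∈ {1, …, n}, then the linear span of the functions β ↦ (βA)^k B u, over k ∈ ℕ and u ∈ ℝ^m, is not dense in C(K,ℝⁿ) with respect to the supremum norm; i.e., the ensemble dX/dt(t,β) = βA X(t,β) + BU(t) is not uniformly ensemble controllable on C(K,ℝⁿ). -/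
/-- For an infinite compact `K ⊂ ℝ`, a constant diagonal `A = diag(ρ₁,…,ρₙ)`
with `ρᵢ = 0` for some `i`, and a constant `B`, the ensemble `Ẋ = βA X + BU` is not
uniformly ensemble controllable on `C(K,ℝⁿ)`: the span of `{β ↦ (βA)^k B u}` is not dense. -/
theorem stmt14 (K : Set ℝ) (hK : IsCompact K) (hKinf : K.Infinite) (n m : ℕ)
    (ρ : Fin n → ℝ) (B : Matrix (Fin n) (Fin m) ℝ)
    (i : Fin n) (hi : ρ i = 0) :
    ¬ Dense (↑(Submodule.span ℝ
        {f : C(K, Fin n → ℝ) | ∃ (k : ℕ) (u : Fin m → ℝ), ∀ β : K,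
          f β = (((β : ℝ) • Matrix.diagonal ρ) ^ k * B).mulVec u}) :
      Set C(K, Fin n → ℝ)) := by
  intro hd
  obtain ⟨a, ha, b, hb, hab⟩ := hKinf.nontrivial
  have hcl : IsClosed {f : C(K, Fin n → ℝ) | f ⟨a, ha⟩ i = f ⟨b, hb⟩ i} := by
    apply isClosed_eq
    · exact (continuous_apply i).comp (continuous_eval_const _)
    · exact (continuous_apply i).comp (continuous_eval_const _)
  have hsub : (↑(Submodule.span ℝ
        {f : C(K, Fin n → ℝ) | ∃ (k : ℕ) (u : Fin m → ℝ), ∀ β : K,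
          f β = (((β : ℝ) • Matrix.diagonal ρ) ^ k * B).mulVec u}) :
      Set C(K, Fin n → ℝ)) ⊆ {f : C(K, Fin n → ℝ) | f ⟨a, ha⟩ i = f ⟨b, hb⟩ i} := by
    intro f hf
    induction hf using Submodule.span_induction with
    | mem f hf =>
      obtain ⟨k, u, h⟩ := hf
      have key : ∀ β : K, f β i = 0 ^ k * (B.mulVec u) i := by
        intro β
        rw [h β, ← Matrix.diagonal_smul, Matrix.diagonal_pow, ← Matrix.mulVec_mulVec,
          Matrix.mulVec_diagonal]
        simp [hi]
      simp only [Set.mem_ofPred_eq, key]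
    | zero => simp
    | add f g _ _ hf hg =>
      simp only [Set.mem_ofPred_eq] at hf hg
      simp [hf, hg]
    | smul c f _ hf =>
      simp only [Set.mem_ofPred_eq] at hf
      simp [hf]
  have hmem := closure_minimal hsub hcl
    (hd (⟨fun β _ => (β : ℝ), by fun_prop⟩ : C(K, Fin n → ℝ)))
  exact hab hmem
end

section
/- Let K ⊂ ℝ be a compact set with 0 ∈ K, let A = diag(ρ₁, …, ρₙ) ∈ ℝ^{n×n} be a constant diagonal matrix, and let B ∈ ℝ^{n×m} be a constant matrix. If the linear span of the functions β ↦ (βA)^k B u, over k ∈ ℕ and u ∈ ℝ^m, is dense in C(K,ℝⁿ) with respect to the supremum norm, then rank B = n (in particular m ≥ n). -/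
/-- For a compact `K ⊂ ℝ` with `0 ∈ K`, a constant diagonal
`A = diag(ρ₁,…,ρₙ)` and a constant `B`, if the ensemble `Ẋ = βA X + BU` is uniformly
ensemble controllable on `C(K,ℝⁿ)` (density of the span of `{β ↦ (βA)^k B u}`), then
`rank B = n` (in particular `m ≥ n`). -/
theorem stmt15 (K : Set ℝ) (hK : IsCompact K) (h0 : (0 : ℝ) ∈ K) (n m : ℕ)
    (ρ : Fin n → ℝ) (B : Matrix (Fin n) (Fin m) ℝ)
    (hdense : Dense (↑(Submodule.span ℝ
        {f : C(K, Fin n → ℝ) | ∃ (k : ℕ) (u : Fin m → ℝ), ∀ β : K,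
          f β = (((β : ℝ) • Matrix.diagonal ρ) ^ k * B).mulVec u}) :
      Set C(K, Fin n → ℝ))) :
    B.rank = n ∧ n ≤ m := by
  have hsub : ∀ f ∈ Submodule.span ℝ
        {f : C(K, Fin n → ℝ) | ∃ (k : ℕ) (u : Fin m → ℝ), ∀ β : K,
          f β = (((β : ℝ) • Matrix.diagonal ρ) ^ k * B).mulVec u},
      f ⟨0, h0⟩ ∈ LinearMap.range B.mulVecLin := by
    intro f hf
    induction hf using Submodule.span_induction with
    | mem f hf =>
      obtain ⟨k, u, h⟩ := hf
      rw [h]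
      cases k with
      | zero => exact ⟨u, by simp⟩
      | succ k => exact ⟨0, by simp⟩
    | zero => exact Submodule.zero_mem _
    | add x y _ _ hx hy => exact Submodule.add_mem _ hx hy
    | smul a x _ hx => exact Submodule.smul_mem _ a hx
  have hclosed : IsClosed ((fun f : C(K, Fin n → ℝ) => f ⟨0, h0⟩) ⁻¹'
      (LinearMap.range B.mulVecLin : Set (Fin n → ℝ))) :=
    (Submodule.closed_of_finiteDimensional _).preimage
      (continuous_eval_const (⟨0, h0⟩ : K))
  have htop : LinearMap.range B.mulVecLin = ⊤ := by
    rw [eq_top_iff]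
    intro v _
    have h1 := closure_minimal (fun f hf => hsub f hf) hclosed
      (hdense (ContinuousMap.const K v))
    exact h1
  have hr : B.rank = n := by
    rw [Matrix.rank, htop]
    simp
  refine ⟨hr, ?_⟩
  have h2 := B.rank_le_width
  omega
end

section
/- Let K ⊂ ℝ be a compact set, let A = diag(ρ₁, …, ρₙ) ∈ ℝ^{n×n} be a constant diagonal matrix with ρᵢ ≠ 0 for all i, and let B ∈ ℝ^{n×m} be a constant matrix. Suppose ξ ∈ ℝ is a shared spectral value of the first r coordinates, i.e., ξ/ρⱼ ∈ K for every j = 1, …, r. If the linear span of the functions β ↦ (βA)^k B u, over k ∈ ℕ and u ∈ ℝ^m, is dense in C(K,ℝⁿ) with respect to the supremum norm, then the r × m submatrix B_r of B consisting of its first r rows has rank r. -/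
/-- For a compact `K ⊂ ℝ`, a constant diagonal `A = diag(ρ₁,…,ρₙ)` with all
`ρᵢ ≠ 0`, a constant `B`, and a shared spectral value `ξ` of the first `r` coordinates
(i.e. `ξ/ρⱼ ∈ K` for `j = 1,…,r`), if the ensemble `Ẋ = βA X + BU` is uniformly ensemble
controllable on `C(K,ℝⁿ)`, then the submatrix `B_r` of the first `r` rows of `B` has
rank `r`. -/
theorem stmt16 (K : Set ℝ) (hK : IsCompact K) (n m : ℕ)
    (ρ : Fin n → ℝ) (hρ : ∀ i, ρ i ≠ 0) (B : Matrix (Fin n) (Fin m) ℝ)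
    (r : ℕ) (hr : r ≤ n) (ξ : ℝ)
    (hshared : ∀ j : Fin r, ξ / ρ (Fin.castLE hr j) ∈ K)
    (hdense : Dense (↑(Submodule.span ℝ
        {f : C(K, Fin n → ℝ) | ∃ (k : ℕ) (u : Fin m → ℝ), ∀ β : K,
          f β = (((β : ℝ) • Matrix.diagonal ρ) ^ k * B).mulVec u}) :
      Set C(K, Fin n → ℝ))) :
    (Matrix.of fun (j : Fin r) (i : Fin m) => B (Fin.castLE hr j) i).rank = r := by
  set Br : Matrix (Fin r) (Fin m) ℝ :=
    Matrix.of fun (j : Fin r) (i : Fin m) => B (Fin.castLE hr j) i with hBr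
  let L : C(K, Fin n → ℝ) →ₗ[ℝ] (Fin r → ℝ) :=
    { toFun := fun f j => f ⟨_, hshared j⟩ (Fin.castLE hr j)
      map_add' := fun f g => rfl
      map_smul' := fun c f => rfl }
  have hL : Continuous L := by
    refine continuous_pi fun j => ?_
    exact (continuous_apply (Fin.castLE hr j)).comp
      (ContinuousEvalConst.continuous_eval_const (F := C(K, Fin n → ℝ)) ⟨_, hshared j⟩)
  have hspan : Submodule.span ℝ
        {f : C(K, Fin n → ℝ) | ∃ (k : ℕ) (u : Fin m → ℝ), ∀ β : K,
          f β = (((β : ℝ) • Matrix.diagonal ρ) ^ k * B).mulVec u}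
      ≤ (LinearMap.range Br.mulVecLin).comap L := by
    rw [Submodule.span_le]
    rintro f ⟨k, u, hf⟩
    refine ⟨ξ ^ k • u, ?_⟩
    ext j
    change Br.mulVec (ξ ^ k • u) j = f ⟨_, hshared j⟩ (Fin.castLE hr j)
    rw [hf, Matrix.mulVec_smul, ← Matrix.diagonal_smul, Matrix.diagonal_pow,
      ← Matrix.mulVec_mulVec, Matrix.mulVec_diagonal]
    have h1 : ξ / ρ (Fin.castLE hr j) * ρ (Fin.castLE hr j) = ξ :=
      div_mul_cancel₀ _ (hρ _)
    simp only [Pi.smul_apply, Pi.pow_apply, smul_eq_mul, h1]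
    rfl
  have hclosed : IsClosed (L ⁻¹' (LinearMap.range Br.mulVecLin : Set (Fin r → ℝ))) :=
    (Submodule.closed_of_finiteDimensional _).preimage hL
  have hall : ∀ f, L f ∈ LinearMap.range Br.mulVecLin := fun f =>
    closure_minimal (fun g hg => hspan hg) hclosed (hdense f)
  have htop : LinearMap.range Br.mulVecLin = ⊤ := by
    rw [eq_top_iff]
    intro v _
    have h := hall (ContinuousMap.const K
      (fun i : Fin n => if h : (i : ℕ) < r then v ⟨i, h⟩ else 0))
    convert h using 1
    ext j
    change v j = (if h : ((Fin.castLE hr j : Fin n) : ℕ) < r then v ⟨_, h⟩ else 0)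
    simp
  rw [Matrix.rank, htop, finrank_top, Module.finrank_fin_fun]
end

section
/- Let K ⊂ ℝ be a nonempty compact set, let λ₁, λ₂ ∈ C(K,ℝ) be injective with disjoint images, λ₁(K) ∩ λ₂(K) = ∅, and let b̃₁, b̃₂ : K → ℝ^{1×m} be continuous with b̃₁(β) ≠ 0 and b̃₂(β) ≠ 0 for all β ∈ K. Write Λ(β) = diag(λ₁(β), λ₂(β)) and let B̃(β) be the 2×m matrix with rows b̃₁(β), b̃₂(β). Then the linear span of the functions β ↦ Λ(β)^k B̃(β)u, over k ∈ ℕ and u ∈ ℝ^m, is dense in C(K,ℝ²) with respect to the supremum norm; i.e., the two-dimensional diagonal ensemble dY/dt(t,β) = Λ(β)Y(t,β) + B̃(β)U(t) is uniformly ensemble controllable on C(K,ℝ²). -/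
/-- A two-dimensional diagonal ensemble whose injective eigenvalue functions
`λ₁, λ₂` have disjoint images and whose rows `b̃₁, b̃₂` are continuous and nowhere vanishing
is uniformly ensemble controllable on `C(K,ℝ²)`: the span of `{β ↦ Λ(β)^k B̃(β)u}` is dense. -/
theorem stmt17 (K : Set ℝ) (hK : IsCompact K) (hKne : K.Nonempty) (m : ℕ)
    (lam1 lam2 : C(K, ℝ))
    (hlam1 : Function.Injective lam1) (hlam2 : Function.Injective lam2)
    (hdisj : Disjoint (Set.range lam1) (Set.range lam2))
    (b1 b2 : K → Fin m → ℝ) (hb1 : Continuous b1) (hb2 : Continuous b2)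
    (hb1ne : ∀ β : K, b1 β ≠ 0) (hb2ne : ∀ β : K, b2 β ≠ 0) :
    Dense (↑(Submodule.span ℝ
        {f : C(K, Fin 2 → ℝ) | ∃ (k : ℕ) (u : Fin m → ℝ), ∀ β : K,
          f β = ((Matrix.diagonal ![lam1 β, lam2 β]) ^ k *
            Matrix.of ![b1 β, b2 β]).mulVec u}) : Set C(K, Fin 2 → ℝ)) := by
  classical
  haveI : CompactSpace K := isCompact_iff_compactSpace.mp hK
  set S : Set C(K, Fin 2 → ℝ) := {f : C(K, Fin 2 → ℝ) | ∃ (k : ℕ) (u : Fin m → ℝ), ∀ β : K,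
          f β = ((Matrix.diagonal ![lam1 β, lam2 β]) ^ k *
            Matrix.of ![b1 β, b2 β]).mulVec u} with hS
  let L : C(K ⊕ K, ℝ) := ⟨Sum.elim lam1 lam2, by fun_prop⟩
  have hL : Function.Injective L := by
    rintro (x | x) (y | y) h
    · exact congrArg _ (hlam1 h)
    · exact (Set.disjoint_left.mp hdisj ⟨x, rfl⟩ ⟨y, (show lam1 x = lam2 y from h).symm⟩).elim
    · exact (Set.disjoint_left.mp hdisj ⟨y, rfl⟩ ⟨x, (show lam2 x = lam1 y from h)⟩).elim
    · exact congrArg _ (hlam2 h)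
  have htop : (Algebra.adjoin ℝ {L}).topologicalClosure = ⊤ := by
    apply ContinuousMap.subalgebra_topologicalClosure_eq_top_of_separatesPoints
    intro x y hxy
    exact ⟨L, ⟨L, Algebra.subset_adjoin rfl, rfl⟩, fun h => hxy (hL h)⟩
  have hd1 : ∀ u : Fin m → ℝ, Continuous fun β => b1 β ⬝ᵥ u := fun u =>
    hb1.dotProduct continuous_const
  have hd2 : ∀ u : Fin m → ℝ, Continuous fun β => b2 β ⬝ᵥ u := fun u =>
    hb2.dotProduct continuous_const
  let Φ : (Fin m → ℝ) → C(K ⊕ K, ℝ) →ₗ[ℝ] C(K, Fin 2 → ℝ) := fun u =>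
    { toFun := fun h => ⟨fun β => ![h (Sum.inl β) * (b1 β ⬝ᵥ u), h (Sum.inr β) * (b2 β ⬝ᵥ u)], by
        have := hd1 u
        have := hd2 u
        refine continuous_pi fun i => ?_
        fin_cases i <;> simp <;> fun_prop⟩
      map_add' := by
        intro x y; ext β i; fin_cases i <;> simp [add_mul]
      map_smul' := by
        intro x y; ext β i; fin_cases i <;> simp [mul_assoc] }
  have hΦc : ∀ u, Continuous (Φ u) := by
    intro u
    apply ContinuousMap.continuous_of_continuous_uncurry
    have := hd1 u
    have := hd2 u
    refine continuous_pi fun i => ?_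
    fin_cases i
    · show Continuous fun p : C(K ⊕ K, ℝ) × K => p.1 (Sum.inl p.2) * (b1 p.2 ⬝ᵥ u)
      fun_prop
    · show Continuous fun p : C(K ⊕ K, ℝ) × K => p.1 (Sum.inr p.2) * (b2 p.2 ⬝ᵥ u)
      fun_prop
  have hadj : ∀ u, ∀ h ∈ Algebra.adjoin ℝ {L}, Φ u h ∈ Submodule.span ℝ S := by
    intro u h hh
    rw [← Subalgebra.mem_toSubmodule, Algebra.adjoin_eq_span] at hh
    induction hh using Submodule.span_induction with
    | mem x hx =>
      obtain ⟨k, rfl⟩ := Submonoid.mem_closure_singleton.mp hx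
      apply Submodule.subset_span
      refine ⟨k, u, fun β => ?_⟩
      rw [← Matrix.mulVec_mulVec, Matrix.diagonal_pow]
      ext i
      rw [Matrix.mulVec_diagonal]
      fin_cases i <;> simp [Φ, L, Matrix.mulVec]
    | zero => simp
    | add x y _ _ hx hy => rw [map_add]; exact add_mem hx hy
    | smul a x _ hx => rw [map_smul]; exact Submodule.smul_mem _ _ hx
  have hall : ∀ u h, Φ u h ∈ (Submodule.span ℝ S).topologicalClosure := by
    intro u h
    have hh : h ∈ (Algebra.adjoin ℝ {L}).topologicalClosure := htop ▸ Algebra.mem_top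
    exact map_mem_closure (hΦc u) hh (hadj u)
  have hpos : ∀ v : Fin m → ℝ, v ≠ 0 → v ⬝ᵥ v ≠ 0 := fun v hv h =>
    hv (dotProduct_self_eq_zero.mp h)
  have hn1 : Continuous fun β => b1 β ⬝ᵥ b1 β := hb1.dotProduct hb1
  have hn2 : Continuous fun β => b2 β ⬝ᵥ b2 β := hb2.dotProduct hb2
  intro f
  let H : Fin m → C(K ⊕ K, ℝ) := fun j =>
    ⟨Sum.elim (fun β => f β 0 * b1 β j / (b1 β ⬝ᵥ b1 β))
      (fun β => f β 1 * b2 β j / (b2 β ⬝ᵥ b2 β)), by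
      refine Continuous.sumElim ?_ ?_
      · exact Continuous.div (by fun_prop) hn1 fun β => hpos _ (hb1ne β)
      · exact Continuous.div (by fun_prop) hn2 fun β => hpos _ (hb2ne β)⟩
  have key : ∀ (a : ℝ) (v : Fin m → ℝ), v ≠ 0 → a = ∑ j, a * v j / (v ⬝ᵥ v) * v j := by
    intro a v hv
    have h1 : ∀ j, a * v j / (v ⬝ᵥ v) * v j = (a / (v ⬝ᵥ v)) * (v j * v j) := fun j => by ring
    simp_rw [h1]
    rw [← Finset.mul_sum]
    exact (div_mul_cancel₀ a (hpos v hv)).symm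
  have hf : f = ∑ j, Φ (Pi.single j 1) (H j) := by
    ext β i
    rw [ContinuousMap.sum_apply, Finset.sum_apply]
    fin_cases i
    · simpa [Φ, H] using key (f β 0) (b1 β) (hb1ne β)
    · simpa [Φ, H] using key (f β 1) (b2 β) (hb2ne β)
  have : f ∈ (Submodule.span ℝ S).topologicalClosure := by
    rw [hf]
    exact sum_mem fun j _ => hall _ _
  exact this
end

section
/- Let A(β) = [[β, 1], [0, β²]] ∈ ℝ^{2×2} and B(β) = [[1, 0, 0], [0, 1, β]] ∈ ℝ^{2×3} for β ∈ [0,1]. Then the linear span of the functions β ↦ A(β)^k B(β)u, over k ∈ ℕ and u ∈ ℝ³, is dense in C([0,1],ℝ²) with respect to the supremum norm; i.e., the ensemble dX/dt(t,β) = A(β)X(t,β) + B(β)U(t) on the parameter interval [0,1] is uniformly ensemble controllable on C([0,1],ℝ²). -/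
open Polynomial in
theorem aux_pow_s18 (k : ℕ) : ∃ p : ℝ[X], ∀ b : ℝ,
    (!![b, 1; 0, b ^ 2]) ^ k = !![b ^ k, p.eval b; 0, b ^ (2 * k)] := by
  induction k with
  | zero => exact ⟨0, fun b => by simp [Matrix.one_fin_two]⟩
  | succ k ih =>
    obtain ⟨p, hp⟩ := ih
    refine ⟨X ^ k + p * X ^ 2, fun b => ?_⟩
    rw [pow_succ, hp b]
    ext i j
    fin_cases i <;> fin_cases j <;> simp [Matrix.mul_apply, Fin.sum_univ_two] <;> ring

noncomputable def auxL (i : Fin 2) :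
    C(Set.Icc (0 : ℝ) 1, ℝ) →L[ℝ] C(Set.Icc (0 : ℝ) 1, Fin 2 → ℝ) :=
  ContinuousLinearMap.compLeftContinuous ℝ _ (ContinuousLinearMap.single ℝ (fun _ => ℝ) i)

theorem auxL_apply (i : Fin 2) (f : C(Set.Icc (0 : ℝ) 1, ℝ)) (b : Set.Icc (0 : ℝ) 1) :
    auxL i f b = Pi.single i (f b) := rfl

noncomputable def auxP : Polynomial ℝ →ₗ[ℝ] C(Set.Icc (0 : ℝ) 1, ℝ) :=
  (Polynomial.toContinuousMapOnAlgHom (Set.Icc (0 : ℝ) 1)).toLinearMap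

theorem auxP_apply (p : Polynomial ℝ) (b : Set.Icc (0 : ℝ) 1) : auxP p b = p.eval (b : ℝ) := by
  simp [auxP]

theorem aux_mono (S : Submodule ℝ C(Set.Icc (0 : ℝ) 1, Fin 2 → ℝ)) (i : Fin 2)
    (h : ∀ n : ℕ, auxL i (auxP (Polynomial.X ^ n)) ∈ S) (p : Polynomial ℝ) :
    auxL i (auxP p) ∈ S := by
  induction p using Polynomial.induction_on' with
  | add p q hp hq => rw [map_add, map_add]; exact S.add_mem hp hq
  | monomial n a =>
    rw [← Polynomial.C_mul_X_pow_eq_monomial, ← Polynomial.smul_eq_C_mul, map_smul, map_smul]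
    exact S.smul_mem _ (h n)

theorem aux_closure (S : Submodule ℝ C(Set.Icc (0 : ℝ) 1, Fin 2 → ℝ)) (i : Fin 2)
    (h : ∀ p, auxL i (auxP p) ∈ S) (f : C(Set.Icc (0 : ℝ) 1, ℝ)) :
    auxL i f ∈ S.topologicalClosure := by
  have hf : f ∈ (polynomialFunctions (Set.Icc (0 : ℝ) 1)).topologicalClosure := by
    rw [polynomialFunctions_closure_eq_top]; trivial
  refine map_mem_closure (auxL i).continuous hf ?_
  rintro _ ⟨p, -, rfl⟩
  exact h p

/-- The ensemble on `β ∈ [0,1]` with `A(β) = [[β,1],[0,β²]]` and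
`B(β) = [[1,0,0],[0,1,β]]` is uniformly ensemble controllable on `C([0,1],ℝ²)`: the span
of `{β ↦ A(β)^k B(β)u : k ∈ ℕ, u ∈ ℝ³}` is dense w.r.t. the sup norm. -/
theorem stmt18 :
    Dense (↑(Submodule.span ℝ
        {f : C(Set.Icc (0 : ℝ) 1, Fin 2 → ℝ) |
          ∃ (k : ℕ) (u : Fin 3 → ℝ), ∀ β : Set.Icc (0 : ℝ) 1,
            f β = ((!![(β : ℝ), 1; 0, (β : ℝ) ^ 2]) ^ k *
              !![(1 : ℝ), 0, 0; 0, 1, (β : ℝ)]).mulVec u}) :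
      Set C(Set.Icc (0 : ℝ) 1, Fin 2 → ℝ)) := by
  set S := Submodule.span ℝ
        {f : C(Set.Icc (0 : ℝ) 1, Fin 2 → ℝ) |
          ∃ (k : ℕ) (u : Fin 3 → ℝ), ∀ β : Set.Icc (0 : ℝ) 1,
            f β = ((!![(β : ℝ), 1; 0, (β : ℝ) ^ 2]) ^ k *
              !![(1 : ℝ), 0, 0; 0, 1, (β : ℝ)]).mulVec u} with hS
  have h0 : ∀ p, auxL 0 (auxP p) ∈ S := by
    refine aux_mono S 0 fun n => Submodule.subset_span ⟨n, ![1, 0, 0], fun b => ?_⟩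
    obtain ⟨p, hp⟩ := aux_pow_s18 n
    rw [hp, auxL_apply, auxP_apply]
    ext i
    fin_cases i <;> simp [Matrix.mulVec, dotProduct, Matrix.mul_apply, Fin.sum_univ_succ]
  have h1 : ∀ p, auxL 1 (auxP p) ∈ S := by
    refine aux_mono S 1 fun n => ?_
    obtain ⟨k, hk⟩ := Nat.even_or_odd' n
    obtain ⟨p, hp⟩ := aux_pow_s18 k
    rcases hk with rfl | rfl
    · rw [← S.add_mem_iff_right (h0 p)]
      refine Submodule.subset_span ⟨k, ![0, 1, 0], fun b => ?_⟩
      rw [hp, ContinuousMap.add_apply, auxL_apply, auxP_apply, auxL_apply, auxP_apply]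
      ext i
      fin_cases i <;> simp [Matrix.mulVec, dotProduct, Matrix.mul_apply, Fin.sum_univ_succ]
    · rw [← S.add_mem_iff_right (h0 (p * Polynomial.X))]
      refine Submodule.subset_span ⟨k, ![0, 0, 1], fun b => ?_⟩
      rw [hp, ContinuousMap.add_apply, auxL_apply, auxP_apply, auxL_apply, auxP_apply]
      ext i
      fin_cases i <;>
        simp [Matrix.mulVec, dotProduct, Matrix.mul_apply, Fin.sum_univ_succ, pow_succ]
  intro f
  have e : f = auxL 0 ⟨fun b => f b 0, by fun_prop⟩ + auxL 1 ⟨fun b => f b 1, by fun_prop⟩ := by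
    ext b i
    rw [ContinuousMap.add_apply, auxL_apply, auxL_apply]
    fin_cases i <;> simp
  rw [e]
  exact S.topologicalClosure.add_mem (aux_closure S 0 h0 _) (aux_closure S 1 h1 _)
end
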